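/- Generalized Gödel–Rosser theorem: let n ≥ 1. No (n−1)-consistent Σₙ-definable extension of Robinson arithmetic Q is Πₙ-deciding: if T ⊇ Q is (n−1)-consistent (for n = 1 this means: consistent) and its set of (Gödel numbers of) axioms is definable in ℕ by a Σₙ-formula, then there exists a Πₙ-sentence γ with T ⊬ γ and T ⊬ ¬γ. -/

import Mathlib

/-!
Formalization of results from "Gödel–Rosser's Incompleteness Theorems for
non-RE Theories" (Salehi & Seraji).

We work in the first-order language of arithmetic `{0, S, +, ×, ≤}` with the
standard model `ℕ`.  Provability `T ⊢ φ` is rendered as the semantic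
consequence `T ⊨ᵇ φ` of Mathlib's model theory library, which by the Gödel
completeness theorem coincides with provability in first-order logic.
-/

open FirstOrder Language BoundedFormula

namespace GRNonRE

/-- Function symbols of arithmetic: `0`, `S`, `+`, `×`. -/
inductive ArithFunc : ℕ → Type
  | zero : ArithFunc 0
  | succ : ArithFunc 1
  | add  : ArithFunc 2
  | mul  : ArithFunc 2

/-- The relation symbol `≤`. -/
inductive ArithRel : ℕ → Type
  | le : ArithRel 2

/-- The first-order language of arithmetic `{0, S, +, ×, ≤}`. -/
def LA : FirstOrder.Language := ⟨ArithFunc, ArithRel⟩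

/-- The standard model `ℕ`. -/
instance : LA.Structure ℕ where
  funMap {_} f := match f with
    | ArithFunc.zero => fun _ => 0
    | ArithFunc.succ => fun v => v 0 + 1
    | ArithFunc.add  => fun v => v 0 + v 1
    | ArithFunc.mul  => fun v => v 0 * v 1
  RelMap {_} r := match r with
    | ArithRel.le => fun v => v 0 ≤ v 1

def zeroT {α : Type} : LA.Term α := Term.func ArithFunc.zero ![]
def succT {α : Type} (t : LA.Term α) : LA.Term α := Term.func ArithFunc.succ ![t]
def addT {α : Type} (t s : LA.Term α) : LA.Term α := Term.func ArithFunc.add ![t, s]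
def mulT {α : Type} (t s : LA.Term α) : LA.Term α := Term.func ArithFunc.mul ![t, s]

/-- The atomic formula `t ≤ s`. -/
def leF {α : Type} {n : ℕ} (t s : LA.Term (α ⊕ Fin n)) : LA.BoundedFormula α n :=
  BoundedFormula.rel ArithRel.le ![t, s]

/-- The numeral `m̄ = S (S ⋯ (S 0))` representing `m : ℕ`. -/
def numeral : ℕ → LA.Term Empty
  | 0 => zeroT
  | n + 1 => succT (numeral n)

instance : Encodable (Σ n, LA.Functions n) :=
  ⟨fun f => match f with
    | ⟨_, ArithFunc.zero⟩ => 0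
    | ⟨_, ArithFunc.succ⟩ => 1
    | ⟨_, ArithFunc.add⟩ => 2
    | ⟨_, ArithFunc.mul⟩ => 3,
   fun n => match n with
    | 0 => some ⟨0, ArithFunc.zero⟩
    | 1 => some ⟨1, ArithFunc.succ⟩
    | 2 => some ⟨2, ArithFunc.add⟩
    | 3 => some ⟨2, ArithFunc.mul⟩
    | _ => none,
   by rintro ⟨n, f⟩; cases f <;> rfl⟩

instance : Encodable (Σ n, LA.Relations n) :=
  ⟨fun _ => 0,
   fun n => match n with
    | 0 => some ⟨2, ArithRel.le⟩
    | _ => none,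
   by rintro ⟨n, r⟩; cases r; rfl⟩

/-- A standard Gödel numbering of formulas, obtained from Mathlib's structural
encoding of bounded formulas as lists of symbols. -/
def godel {k : ℕ} (φ : LA.BoundedFormula Empty k) : ℕ :=
  Encodable.encode φ.listEncode

/-- Lift a term in context `k` to context `k + 1`. -/
def liftT {k : ℕ} (t : LA.Term (Empty ⊕ Fin k)) : LA.Term (Empty ⊕ Fin (k + 1)) :=
  t.relabel (Sum.map id Fin.castSucc)

/-- The class `Σ₀ = Π₀ = Δ₀` of bounded formulas: built from atomic formulas by
Boolean connectives (`⊥` and `⟹`, from which `∼`, `⊓`, `⊔` are definable) and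
bounded universal quantification `∀ x ≤ t, φ` (bounded existential
quantification `∃ x ≤ t, φ` is expressible as `∼ ∀ x ≤ t, ∼φ`). -/
inductive Delta0 : ∀ {k : ℕ}, LA.BoundedFormula Empty k → Prop
  | falsum {k : ℕ} : Delta0 (⊥ : LA.BoundedFormula Empty k)
  | equal {k : ℕ} (t₁ t₂ : LA.Term (Empty ⊕ Fin k)) : Delta0 (t₁ =' t₂)
  | le {k : ℕ} (t₁ t₂ : LA.Term (Empty ⊕ Fin k)) : Delta0 (leF t₁ t₂)
  | imp {k : ℕ} {φ ψ : LA.BoundedFormula Empty k} :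
      Delta0 φ → Delta0 ψ → Delta0 (φ ⟹ ψ)
  | bdall {k : ℕ} (t : LA.Term (Empty ⊕ Fin k)) {φ : LA.BoundedFormula Empty (k + 1)} :
      Delta0 φ → Delta0 ((leF (&(Fin.last k)) (liftT t) ⟹ φ).all)

mutual
  /-- The classes `Σₙ` of the arithmetical hierarchy: `Σ₀` is the class of
  bounded formulas, and `Σ_{n+1}` contains `Πₙ` and is closed under `⊓`, `⊔`,
  existential quantification and bounded universal quantification. -/
  inductive IsSigma : ℕ → ∀ {k : ℕ}, LA.BoundedFormula Empty k → Prop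
    | ofDelta0 {k : ℕ} {φ : LA.BoundedFormula Empty k} : Delta0 φ → IsSigma 0 φ
    | ofPi {n k : ℕ} {φ : LA.BoundedFormula Empty k} :
        IsPi n φ → IsSigma (n + 1) φ
    | ex {n k : ℕ} {φ : LA.BoundedFormula Empty (k + 1)} :
        IsSigma (n + 1) φ → IsSigma (n + 1) φ.ex
    | inf {n k : ℕ} {φ ψ : LA.BoundedFormula Empty k} :
        IsSigma (n + 1) φ → IsSigma (n + 1) ψ → IsSigma (n + 1) (φ ⊓ ψ)
    | sup {n k : ℕ} {φ ψ : LA.BoundedFormula Empty k} :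
        IsSigma (n + 1) φ → IsSigma (n + 1) ψ → IsSigma (n + 1) (φ ⊔ ψ)
    | bdall {n k : ℕ} (t : LA.Term (Empty ⊕ Fin k))
        {φ : LA.BoundedFormula Empty (k + 1)} :
        IsSigma (n + 1) φ → IsSigma (n + 1) ((leF (&(Fin.last k)) (liftT t) ⟹ φ).all)

  /-- The classes `Πₙ` of the arithmetical hierarchy: `Π₀` is the class of
  bounded formulas, and `Π_{n+1}` contains `Σₙ` and is closed under `⊓`, `⊔`,
  universal quantification and bounded existential quantification. -/
  inductive IsPi : ℕ → ∀ {k : ℕ}, LA.BoundedFormula Empty k → Prop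
    | ofDelta0 {k : ℕ} {φ : LA.BoundedFormula Empty k} : Delta0 φ → IsPi 0 φ
    | ofSigma {n k : ℕ} {φ : LA.BoundedFormula Empty k} :
        IsSigma n φ → IsPi (n + 1) φ
    | all {n k : ℕ} {φ : LA.BoundedFormula Empty (k + 1)} :
        IsPi (n + 1) φ → IsPi (n + 1) φ.all
    | inf {n k : ℕ} {φ ψ : LA.BoundedFormula Empty k} :
        IsPi (n + 1) φ → IsPi (n + 1) ψ → IsPi (n + 1) (φ ⊓ ψ)
    | sup {n k : ℕ} {φ ψ : LA.BoundedFormula Empty k} :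
        IsPi (n + 1) φ → IsPi (n + 1) ψ → IsPi (n + 1) (φ ⊔ ψ)
    | bdex {n k : ℕ} (t : LA.Term (Empty ⊕ Fin k))
        {φ : LA.BoundedFormula Empty (k + 1)} :
        IsPi (n + 1) φ → IsPi (n + 1) ((leF (&(Fin.last k)) (liftT t) ⊓ φ).ex)
end

/-- `T ⊢ φ`: by the Gödel completeness theorem, provability of the sentence `φ`
from the theory `T` coincides with the semantic consequence relation. -/
def Proves (T : LA.Theory) (φ : LA.Sentence) : Prop := T ⊨ᵇ φ

/-- Consistency of a theory. -/
def Consistent (T : LA.Theory) : Prop := ¬ Proves T ⊥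

/-- `ψ(m̄)`: the result of substituting the numeral `m̄` for the free variable
of a formula `ψ(x)` with one free variable. -/
def subst1 (ψ : LA.BoundedFormula Empty 1) (m : ℕ) : LA.Sentence :=
  ψ.toFormula.subst fun _ => numeral m

/-- `n`-consistency: there is no formula `ψ(x) ∈ Π_{n-1}` such that `T ⊢ ¬ψ(m̄)`
for every numeral `m̄` (`m ∈ ℕ`) and yet `T ⊢ ∃x ψ(x)`.
(`0`-consistency is ordinary consistency.) -/
def NCon : ℕ → LA.Theory → Prop
  | 0, T => Consistent T
  | n + 1, T => ¬ ∃ ψ : LA.BoundedFormula Empty 1, IsPi n ψ ∧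
      (∀ m : ℕ, Proves T (∼(subst1 ψ m))) ∧ Proves T ψ.ex

/-- The axioms of Robinson arithmetic `Q`:
`Sx ≠ 0`, `Sx = Sy → x = y`, `x ≠ 0 → ∃y x = Sy`, `x + 0 = x`,
`x + Sy = S(x + y)`, `x·0 = 0`, `x·Sy = x·y + x`, `x ≤ y ↔ ∃z z + x = y`. -/
def QTheory : LA.Theory :=
  { ∀' ∼(succT (&0) =' zeroT),
    ∀' ∀' ((succT (&0) =' succT (&1)) ⟹ (&0 =' &1)),
    ∀' (∼(&0 =' zeroT) ⟹ ∃' (&0 =' succT (&1))),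
    ∀' (addT (&0) zeroT =' &0),
    ∀' ∀' (addT (&0) (succT (&1)) =' succT (addT (&0) (&1))),
    ∀' (mulT (&0) zeroT =' zeroT),
    ∀' ∀' (mulT (&0) (succT (&1)) =' addT (mulT (&0) (&1)) (&0)),
    ((leF (&0) (&1) ⇔ ∃' (addT (&2) (&0) =' (&1)) : LA.BoundedFormula Empty 2)).alls }

/-- `T` is an extension of Robinson arithmetic `Q` (i.e. `T` proves `Q`). -/
def ExtendsQ (T : LA.Theory) : Prop := ∀ φ ∈ QTheory, Proves T φ

/-- `Πₙ-Th(ℕ)`: the set of `Πₙ`-sentences true in the standard model. -/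
def PiTh (n : ℕ) : LA.Theory := {φ | IsPi n φ ∧ ℕ ⊨ φ}

/-- Soundness: every theorem of `T` is true in `ℕ`. -/
def Sound (T : LA.Theory) : Prop := ∀ φ : LA.Sentence, Proves T φ → ℕ ⊨ φ

/-- `Σₙ`-soundness: every `Σₙ`-sentence provable in `T` is true in `ℕ`. -/
def SigmaSound (n : ℕ) (T : LA.Theory) : Prop :=
  ∀ φ : LA.Sentence, IsSigma n φ → Proves T φ → ℕ ⊨ φ

/-- A formula `Ψ(x)` with one free variable defines the set `A ⊆ ℕ` in `ℕ`. -/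
def Defines (Ψ : LA.BoundedFormula Empty 1) (A : Set ℕ) : Prop :=
  ∀ m : ℕ, m ∈ A ↔ Ψ.Realize (fun e => Empty.elim e) ![m]

/-- `A ⊆ ℕ` is definable in `ℕ` by a `Σₙ`-formula. -/
def SigmaDefinable (n : ℕ) (A : Set ℕ) : Prop := ∃ Ψ, IsSigma n Ψ ∧ Defines Ψ A

/-- `A ⊆ ℕ` is definable in `ℕ` by a `Πₙ`-formula. -/
def PiDefinable (n : ℕ) (A : Set ℕ) : Prop := ∃ Ψ, IsPi n Ψ ∧ Defines Ψ A

/-- The set of Gödel numbers of the axioms of `T`. -/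
def axiomCodes (T : LA.Theory) : Set ℕ := {m | ∃ φ ∈ T, godel φ = m}

/-- The set of Gödel numbers of the theorems of `T` (its deductive closure). -/
def theoremCodes (T : LA.Theory) : Set ℕ := {m | ∃ φ, Proves T φ ∧ godel φ = m}

/-! ### The arithmetical hierarchy of predicates on primitively codable types -/

/-- The predicates of the form `∃ y₁, ∀ y₂, ∃ y₃, …` (`n` alternating quantifiers in front of a
primitive recursive matrix); `SigmaPred n` complements describe the dual classes. -/
def SigmaPred : ℕ → ∀ {α : Type} [Primcodable α], (α → Prop) → Prop
  | 0, _, _, R => PrimrecPred R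
  | n + 1, α, _, R => ∃ P : α × ℕ → Prop, SigmaPred n P ∧ ∀ a, R a ↔ ∃ y, ¬ P (a, y)

namespace SigmaPred

variable {α β : Type} [Primcodable α] [Primcodable β] {n : ℕ}

theorem of_iff {R S : α → Prop} (h : SigmaPred n R) (H : ∀ a, R a ↔ S a) : SigmaPred n S := by
  obtain rfl : R = S := funext fun a => propext (H a)
  exact h

theorem comp {R : β → Prop} (h : SigmaPred n R) {f : α → β} (hf : Primrec f) :
    SigmaPred n fun a => R (f a) := by
  induction n generalizing α β with
  | zero => exact PrimrecPred.comp h hf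
  | succ n ih =>
    obtain ⟨P, hP, H⟩ := h
    exact ⟨fun p => P (f p.1, p.2),
      ih hP ((hf.comp Primrec.fst).pair Primrec.snd), fun a => H (f a)⟩

theorem of_not {R : α → Prop} (h : SigmaPred n fun a => ¬ R a) : SigmaPred (n + 1) R :=
  ⟨fun p => ¬ R p.1, h.comp Primrec.fst, fun a => by simp⟩

theorem succ {R : α → Prop} (h : SigmaPred n R) : SigmaPred (n + 1) R := by
  induction n generalizing α with
  | zero => exact of_not (PrimrecPred.not h)
  | succ n ih =>
    obtain ⟨P, hP, H⟩ := h
    exact ⟨P, ih hP, H⟩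

theorem of_primrecPred {R : α → Prop} (h : PrimrecPred R) : SigmaPred n R := by
  induction n with
  | zero => exact h
  | succ n ih => exact ih.succ

theorem and_or {R S : α → Prop} (hR : SigmaPred n R) (hS : SigmaPred n S) :
    SigmaPred n (fun a => R a ∧ S a) ∧ SigmaPred n (fun a => R a ∨ S a) := by
  induction n generalizing α with
  | zero => exact ⟨PrimrecPred.and hR hS, PrimrecPred.or hR hS⟩
  | succ n ih =>
    obtain ⟨P, hP, HP⟩ := hR
    obtain ⟨P', hP', HP'⟩ := hS
    have u : Primrec fun p : α × ℕ => p.2.unpair := Primrec.unpair.comp Primrec.snd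
    refine ⟨⟨fun p => P (p.1, p.2.unpair.1) ∨ P' (p.1, p.2.unpair.2),
      (ih (hP.comp (Primrec.fst.pair (Primrec.fst.comp u)))
        (hP'.comp (Primrec.fst.pair (Primrec.snd.comp u)))).2, fun a => ?_⟩,
      ⟨fun p => P p ∧ P' p, (ih hP hP').1, fun a => ?_⟩⟩
    · simp only [HP, HP', not_or]
      constructor
      · rintro ⟨⟨x, hx⟩, y, hy⟩
        exact ⟨Nat.pair x y, by simpa using ⟨hx, hy⟩⟩
      · rintro ⟨z, hz⟩
        exact ⟨⟨_, hz.1⟩, _, hz.2⟩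
    · simp only [HP, HP', not_and_or, exists_or]

theorem and {R S : α → Prop} (hR : SigmaPred n R) (hS : SigmaPred n S) :
    SigmaPred n fun a => R a ∧ S a := (and_or hR hS).1

theorem or {R S : α → Prop} (hR : SigmaPred n R) (hS : SigmaPred n S) :
    SigmaPred n fun a => R a ∨ S a := (and_or hR hS).2

theorem exists_nat {R : α × ℕ → Prop} (h : SigmaPred (n + 1) R) :
    SigmaPred (n + 1) fun a => ∃ x, R (a, x) := by
  obtain ⟨P, hP, H⟩ := h
  have u : Primrec fun p : α × ℕ => p.2.unpair := Primrec.unpair.comp Primrec.snd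
  refine ⟨fun p => P ((p.1, p.2.unpair.1), p.2.unpair.2),
    hP.comp ((Primrec.fst.pair (Primrec.fst.comp u)).pair (Primrec.snd.comp u)), fun a => ?_⟩
  simp only [H]
  constructor
  · rintro ⟨x, y, h⟩
    exact ⟨Nat.pair x y, by simpa using h⟩
  · rintro ⟨z, h⟩
    exact ⟨_, _, h⟩

theorem exists_of_inhabited [Inhabited β] {R : α × β → Prop} (h : SigmaPred (n + 1) R) :
    SigmaPred (n + 1) fun a => ∃ x, R (a, x) := by
  refine (exists_nat (R := fun p => R (p.1, (Encodable.decode p.2).getD default))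
    (h.comp (Primrec.fst.pair (Primrec.option_getD_default.comp
      (Primrec.decode.comp Primrec.snd))))).of_iff fun a => ?_
  constructor
  · rintro ⟨x, hx⟩
    exact ⟨_, hx⟩
  · rintro ⟨x, hx⟩
    exact ⟨Encodable.encode x, by simpa using hx⟩

theorem bounded {R : α × ℕ → Prop} (h : SigmaPred n R) {b : α → ℕ} (hb : Primrec b) :
    SigmaPred n (fun a => ∀ x < b a, R (a, x)) ∧ SigmaPred n (fun a => ∃ x < b a, R (a, x)) := by
  induction n generalizing α with
  | zero =>
    have hR : PrimrecRel fun (x : ℕ) (a : α) => R (a, x) :=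
      PrimrecPred.comp h (Primrec.snd.pair Primrec.fst)
    exact ⟨(hR.forall_mem_list.comp (Primrec.list_range.comp hb) Primrec.id).of_eq
        fun a => by simp,
      (hR.exists_mem_list.comp (Primrec.list_range.comp hb) Primrec.id).of_eq
        fun a => by simp⟩
  | succ n ih =>
    obtain ⟨P, hP, H⟩ := h
    constructor
    · let s : ℕ → ℕ → ℕ := fun z x => (Denumerable.ofNat (List ℕ) z).getD x 0
      have hs : Primrec₂ s :=
        (Primrec.list_getD 0).comp₂ ((Primrec.ofNat (List ℕ)).comp₂ Primrec₂.left) Primrec₂.right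
      have h' : SigmaPred n fun q : (α × ℕ) × ℕ => P ((q.1.1, q.2), s q.1.2 q.2) :=
        hP.comp (((Primrec.fst.comp Primrec.fst).pair Primrec.snd).pair
          (hs.comp (Primrec.snd.comp Primrec.fst) Primrec.snd))
      refine ⟨fun p => ∃ x < b p.1, P ((p.1, x), s p.2 x),
        (ih h' (b := fun p => b p.1) (hb.comp Primrec.fst)).2, fun a => ?_⟩
      simp only [H, not_exists, not_and]
      constructor
      · intro hx
        choose! y hy using hx
        refine ⟨Encodable.encode ((List.range (b a)).map y), fun x hxb => ?_⟩
        have : s (Encodable.encode ((List.range (b a)).map y)) x = y x := by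
          simp [s, List.getD, hxb]
        rw [this]
        exact hy x hxb
      · rintro ⟨z, hz⟩ x hx
        exact ⟨_, hz x hx⟩
    · have hlt : SigmaPred (n + 1) fun p : α × ℕ => p.2 < b p.1 :=
        of_primrecPred (Primrec.nat_lt.comp Primrec.snd (hb.comp Primrec.fst))
      have hR : SigmaPred (n + 1) R := ⟨P, hP, H⟩
      exact exists_nat (hlt.and hR)

theorem forall_lt {R : α × ℕ → Prop} (h : SigmaPred n R) {b : α → ℕ} (hb : Primrec b) :
    SigmaPred n fun a => ∀ x < b a, R (a, x) := (bounded h hb).1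

end SigmaPred

/-! ### Formulas define predicates of the corresponding complexity -/

section Realize

variable {α : Type} [Primcodable α]

theorem primrec_realize_term {k : ℕ} (t : LA.Term (Empty ⊕ Fin k)) {f : Fin k → α → ℕ}
    (hf : ∀ i, Primrec (f i)) :
    Primrec fun a => t.realize (Sum.elim (Empty.elim : Empty → ℕ) fun i => f i a) := by
  induction t with
  | var x =>
    rcases x with x | x
    · exact x.elim
    · exact hf x
  | func g ts ih =>
    cases g with
    | zero => exact Primrec.const 0
    | succ => exact Primrec.succ.comp (ih 0)
    | add => exact Primrec.nat_add.comp (ih 0) (ih 1)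
    | mul => exact Primrec.nat_mul.comp (ih 0) (ih 1)

theorem realize_liftT {M : Type} [LA.Structure M] {k : ℕ} (t : LA.Term (Empty ⊕ Fin k))
    (xs : Fin k → M) (x : M) :
    (liftT t).realize (Sum.elim (Empty.elim : Empty → M) (Fin.snoc xs x)) =
      t.realize (Sum.elim Empty.elim xs) := by
  rw [liftT, Term.realize_relabel]
  congr 1
  funext i
  rcases i with i | i
  · exact i.elim
  · simp

theorem realize_leF_last {M : Type} [LA.Structure M] {k : ℕ} (t : LA.Term (Empty ⊕ Fin k))
    (xs : Fin k → M) (x : M) :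
    (leF (&(Fin.last k)) (liftT t)).Realize (Empty.elim : Empty → M) (Fin.snoc xs x) ↔
      Structure.RelMap (L := LA) ArithRel.le ![x, t.realize (Sum.elim Empty.elim xs)] := by
  simp only [leF, Realize]
  rw [← realize_liftT t xs x]
  apply iff_of_eq
  congr 1
  funext i
  fin_cases i
  · simp
  · rfl

theorem realize_leF_last_nat {k : ℕ} (t : LA.Term (Empty ⊕ Fin k)) (xs : Fin k → ℕ) (x : ℕ) :
    (leF (&(Fin.last k)) (liftT t)).Realize (Empty.elim : Empty → ℕ) (Fin.snoc xs x) ↔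
      x < t.realize (Sum.elim Empty.elim xs) + 1 := by
  exact (realize_leF_last t xs x).trans Nat.lt_succ_iff.symm

theorem primrec_snoc {k : ℕ} {f : Fin k → α → ℕ} (hf : ∀ i, Primrec (f i)) (i : Fin (k + 1)) :
    Primrec fun p : α × ℕ => (Fin.snoc (fun i => f i p.1) p.2 : Fin (k + 1) → ℕ) i := by
  refine Fin.lastCases ?_ (fun i => ?_) i
  · simpa using Primrec.snd
  · simpa using (hf i).comp Primrec.fst

theorem Delta0.primrecPred {k : ℕ} {φ : LA.BoundedFormula Empty k} (h : Delta0 φ) :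
    ∀ {α : Type} [Primcodable α] {f : Fin k → α → ℕ}, (∀ i, Primrec (f i)) →
      PrimrecPred fun a => φ.Realize (Empty.elim : Empty → ℕ) fun i => f i a := by
  induction h with
  | falsum =>
    intro α _ f hf
    exact SigmaPred.of_iff (n := 0) (R := fun _ => ¬ 0 = 0)
      (PrimrecPred.not (Primrec.eq.comp (Primrec.const 0) (Primrec.const 0))) fun a => by simp
  | equal t₁ t₂ =>
    intro α _ f hf
    exact Primrec.eq.comp (primrec_realize_term t₁ hf) (primrec_realize_term t₂ hf)
  | le t₁ t₂ =>
    intro α _ f hf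
    exact Primrec.nat_le.comp (primrec_realize_term t₁ hf) (primrec_realize_term t₂ hf)
  | imp _ _ ih₁ ih₂ =>
    intro α _ f hf
    exact ((ih₁ hf).not.or (ih₂ hf)).of_eq fun a => by simp [imp_iff_not_or]
  | bdall t _ ih =>
    intro α _ f hf
    refine ((SigmaPred.forall_lt (n := 0) (ih (primrec_snoc hf))
      (Primrec.succ.comp (primrec_realize_term t hf))) : PrimrecPred _).of_eq fun a => ?_
    simp only [realize_all, realize_imp, realize_leF_last_nat]

mutual

theorem IsSigma.sigmaPred {n k : ℕ} {φ : LA.BoundedFormula Empty k} (h : IsSigma n φ)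
    {α : Type} [Primcodable α] {f : Fin k → α → ℕ} (hf : ∀ i, Primrec (f i)) :
    SigmaPred n fun a => φ.Realize (Empty.elim : Empty → ℕ) fun i => f i a := by
  match h with
  | .ofDelta0 h => exact h.primrecPred hf
  | .ofPi h => exact SigmaPred.of_not (IsPi.sigmaPred_not h hf)
  | .ex h =>
    exact (SigmaPred.exists_nat (IsSigma.sigmaPred h (primrec_snoc hf))).of_iff
      fun a => by simp only [realize_ex]
  | .inf h₁ h₂ =>
    exact ((IsSigma.sigmaPred h₁ hf).and (IsSigma.sigmaPred h₂ hf)).of_iff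
      fun a => by simp only [realize_inf]
  | .sup h₁ h₂ =>
    exact ((IsSigma.sigmaPred h₁ hf).or (IsSigma.sigmaPred h₂ hf)).of_iff
      fun a => by simp only [realize_sup]
  | .bdall t h =>
    exact (SigmaPred.forall_lt (IsSigma.sigmaPred h (primrec_snoc hf))
      (Primrec.succ.comp (primrec_realize_term t hf))).of_iff
      fun a => by simp only [realize_all, realize_imp, realize_leF_last_nat]

theorem IsPi.sigmaPred_not {n k : ℕ} {φ : LA.BoundedFormula Empty k} (h : IsPi n φ)
    {α : Type} [Primcodable α] {f : Fin k → α → ℕ} (hf : ∀ i, Primrec (f i)) :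
    SigmaPred n fun a => ¬ φ.Realize (Empty.elim : Empty → ℕ) fun i => f i a := by
  match h with
  | .ofDelta0 h => exact (h.primrecPred hf).not
  | .ofSigma h => exact SigmaPred.of_not (by simpa using IsSigma.sigmaPred h hf)
  | .all h =>
    exact (SigmaPred.exists_nat (IsPi.sigmaPred_not h (primrec_snoc hf))).of_iff
      fun a => by simp only [realize_all, not_forall]
  | .inf h₁ h₂ =>
    exact ((IsPi.sigmaPred_not h₁ hf).or (IsPi.sigmaPred_not h₂ hf)).of_iff
      fun a => by simp only [realize_inf, not_and_or]
  | .sup h₁ h₂ =>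
    exact ((IsPi.sigmaPred_not h₁ hf).and (IsPi.sigmaPred_not h₂ hf)).of_iff
      fun a => by simp only [realize_sup, not_or]
  | .bdex t h =>
    exact (SigmaPred.forall_lt (IsPi.sigmaPred_not h (primrec_snoc hf))
      (Primrec.succ.comp (primrec_realize_term t hf))).of_iff
      fun a => by
        simp only [realize_ex, realize_inf, realize_leF_last_nat, not_exists, not_and]

end

end Realize

/-! ### Models of Robinson arithmetic -/

section Operations

variable {M : Type} [LA.Structure M]

/-- Interpretation of `0`. -/
def zeroM (M : Type) [LA.Structure M] : M := Structure.funMap (L := LA) ArithFunc.zero ![]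

/-- Interpretation of `S`. -/
def succM (x : M) : M := Structure.funMap (L := LA) ArithFunc.succ ![x]

/-- Interpretation of `+`. -/
def addM (x y : M) : M := Structure.funMap (L := LA) ArithFunc.add ![x, y]

/-- Interpretation of `×`. -/
def mulM (x y : M) : M := Structure.funMap (L := LA) ArithFunc.mul ![x, y]

/-- Interpretation of `≤`. -/
def leM (x y : M) : Prop := Structure.RelMap (L := LA) ArithRel.le ![x, y]

/-- The value of the numeral of `m` in `M`. -/
def natM (M : Type) [LA.Structure M] : ℕ → M
  | 0 => zeroM M
  | m + 1 => succM (natM M m)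

variable {β : Type} (v : β → M)

theorem realize_func_zero (ts : Fin 0 → LA.Term β) :
    (Term.func (L := LA) ArithFunc.zero ts).realize v = zeroM M :=
  congrArg (Structure.funMap (L := LA) ArithFunc.zero) (funext fun i => i.elim0)

theorem realize_func_succ (ts : Fin 1 → LA.Term β) :
    (Term.func (L := LA) ArithFunc.succ ts).realize v = succM ((ts 0).realize v) :=
  congrArg (Structure.funMap (L := LA) ArithFunc.succ) (funext fun i => by fin_cases i; rfl)

theorem realize_func_add (ts : Fin 2 → LA.Term β) :
    (Term.func (L := LA) ArithFunc.add ts).realize v =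
      addM ((ts 0).realize v) ((ts 1).realize v) :=
  congrArg (Structure.funMap (L := LA) ArithFunc.add) (funext fun i => by fin_cases i <;> rfl)

theorem realize_func_mul (ts : Fin 2 → LA.Term β) :
    (Term.func (L := LA) ArithFunc.mul ts).realize v =
      mulM ((ts 0).realize v) ((ts 1).realize v) :=
  congrArg (Structure.funMap (L := LA) ArithFunc.mul) (funext fun i => by fin_cases i <;> rfl)

theorem realize_zeroT : (zeroT : LA.Term β).realize v = zeroM M := realize_func_zero v _

theorem realize_succT (t : LA.Term β) : (succT t).realize v = succM (t.realize v) :=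
  realize_func_succ v _

theorem realize_addT (t s : LA.Term β) :
    (addT t s).realize v = addM (t.realize v) (s.realize v) := realize_func_add v _

theorem realize_mulT (t s : LA.Term β) :
    (mulT t s).realize v = mulM (t.realize v) (s.realize v) := realize_func_mul v _

theorem realize_rel_le {k : ℕ} (ts : Fin 2 → LA.Term (Empty ⊕ Fin k)) (w : Empty → M)
    (xs : Fin k → M) :
    (BoundedFormula.rel (L := LA) ArithRel.le ts).Realize w xs ↔
      leM ((ts 0).realize (Sum.elim w xs)) ((ts 1).realize (Sum.elim w xs)) := by
  refine iff_of_eq (congrArg (Structure.RelMap (L := LA) ArithRel.le) (funext fun i => ?_))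
  fin_cases i <;> rfl

theorem realize_leF {k : ℕ} (t s : LA.Term (Empty ⊕ Fin k)) (w : Empty → M) (xs : Fin k → M) :
    (leF t s).Realize w xs ↔ leM (t.realize (Sum.elim w xs)) (s.realize (Sum.elim w xs)) :=
  realize_rel_le _ w xs

theorem realize_numeral (m : ℕ) (w : Empty → M) : (numeral m).realize w = natM M m := by
  induction m with
  | zero => exact realize_zeroT w
  | succ m ih => rw [numeral, realize_succT, ih, natM]

theorem natM_nat (m : ℕ) : natM ℕ m = m := by
  induction m with
  | zero => rfl
  | succ m ih => rw [natM, ih]; rfl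

theorem natM_comp_snoc {k : ℕ} (M : Type) [LA.Structure M] (xs : Fin k → ℕ) (i : ℕ) :
    (Fin.snoc (fun j => natM M (xs j)) (natM M i) : Fin (k + 1) → M) =
      fun j => natM M ((Fin.snoc xs i : Fin (k + 1) → ℕ) j) := by
  funext j
  refine Fin.lastCases ?_ (fun j => ?_) j <;> simp

end Operations

/-- The axioms of `Q`, stated for the operations of a structure. -/
structure IsQModel (M : Type) [LA.Structure M] : Prop where
  succ_ne_zero : ∀ x : M, succM x ≠ zeroM M
  succ_inj : ∀ x y : M, succM x = succM y → x = y
  exists_pred : ∀ x : M, x ≠ zeroM M → ∃ y, x = succM y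
  add_zero : ∀ x : M, addM x (zeroM M) = x
  add_succ : ∀ x y : M, addM x (succM y) = succM (addM x y)
  mul_zero : ∀ x : M, mulM x (zeroM M) = zeroM M
  mul_succ : ∀ x y : M, mulM x (succM y) = addM (mulM x y) x
  le_iff : ∀ x y : M, leM x y ↔ ∃ z, addM z x = y

theorem isQModel_of_realize {M : Type} [LA.Structure M] (h : ∀ φ ∈ QTheory, M ⊨ φ) :
    IsQModel M := by
  simp only [QTheory, Set.mem_insert_iff, Set.mem_singleton_iff, forall_eq_or_imp,
    forall_eq] at h
  obtain ⟨h₁, h₂, h₃, h₄, h₅, h₆, h₇, h₈⟩ := h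
  simp only [Sentence.Realize, Formula.Realize, realize_all, realize_not, realize_imp,
    realize_bdEqual, realize_succT, realize_zeroT, realize_ex, realize_addT, realize_mulT,
    Term.realize_var, Function.comp_apply, Sum.elim_inr] at h₁ h₂ h₃ h₄ h₅ h₆ h₇
  simp only [Sentence.Realize, realize_alls, realize_iff, realize_leF, realize_ex,
    realize_bdEqual, realize_addT, Term.realize_var, Function.comp_apply, Sum.elim_inr] at h₈
  exact ⟨h₁, h₂, h₃, h₄, h₅, h₆, h₇, fun x y => h₈ ![x, y]⟩

namespace IsQModel

variable {M : Type} [LA.Structure M]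

theorem natM_add (hM : IsQModel M) (a b : ℕ) : addM (natM M a) (natM M b) = natM M (a + b) := by
  induction b with
  | zero => exact hM.add_zero _
  | succ b ih => rw [natM, hM.add_succ, ih]; rfl

theorem natM_mul (hM : IsQModel M) (a b : ℕ) : mulM (natM M a) (natM M b) = natM M (a * b) := by
  induction b with
  | zero => exact hM.mul_zero _
  | succ b ih => rw [natM, hM.mul_succ, ih, hM.natM_add, Nat.mul_succ]

theorem natM_inj (hM : IsQModel M) {a b : ℕ} : natM M a = natM M b ↔ a = b := by
  refine ⟨fun h => ?_, fun h => h ▸ rfl⟩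
  induction a generalizing b with
  | zero =>
    cases b with
    | zero => rfl
    | succ b => exact absurd h.symm (hM.succ_ne_zero _)
  | succ a ih =>
    cases b with
    | zero => exact absurd h (hM.succ_ne_zero _)
    | succ b => rw [ih (hM.succ_inj _ _ h)]

theorem eq_natM_of_add (hM : IsQModel M) {x z : M} {m : ℕ} (h : addM z x = natM M m) :
    ∃ i ≤ m, x = natM M i := by
  induction m generalizing x with
  | zero =>
    by_cases hx : x = zeroM M
    · exact ⟨0, le_rfl, hx⟩
    · obtain ⟨y, rfl⟩ := hM.exists_pred x hx
      rw [hM.add_succ] at h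
      exact absurd h (hM.succ_ne_zero _)
  | succ m ih =>
    by_cases hx : x = zeroM M
    · exact ⟨0, Nat.zero_le _, hx⟩
    · obtain ⟨y, rfl⟩ := hM.exists_pred x hx
      rw [hM.add_succ] at h
      obtain ⟨i, hi, rfl⟩ := ih (hM.succ_inj _ _ h)
      exact ⟨i + 1, by omega, rfl⟩

theorem le_natM_iff (hM : IsQModel M) {x : M} {m : ℕ} : leM x (natM M m) ↔ ∃ i ≤ m, x = natM M i := by
  rw [hM.le_iff]
  constructor
  · rintro ⟨z, hz⟩
    exact hM.eq_natM_of_add hz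
  · rintro ⟨i, hi, rfl⟩
    exact ⟨natM M (m - i), by rw [hM.natM_add, Nat.sub_add_cancel hi]⟩

/-- Every element is a numeral below `m` or has the form `z + m`. -/
theorem exists_natM_or_add (hM : IsQModel M) (y : M) (m : ℕ) :
    (∃ i < m, y = natM M i) ∨ ∃ z, addM z (natM M m) = y := by
  induction m generalizing y with
  | zero => exact .inr ⟨y, hM.add_zero y⟩
  | succ m ih =>
    by_cases hy : y = zeroM M
    · exact .inl ⟨0, Nat.succ_pos _, hy⟩
    · obtain ⟨x, rfl⟩ := hM.exists_pred y hy
      rcases ih x with ⟨i, hi, rfl⟩ | ⟨z, rfl⟩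
      · exact .inl ⟨i + 1, by omega, rfl⟩
      · exact .inr ⟨z, hM.add_succ _ _⟩

theorem le_or_natM_le (hM : IsQModel M) (y : M) (m : ℕ) : (∃ i < m, y = natM M i) ∨ leM (natM M m) y := by
  rw [hM.le_iff]
  exact hM.exists_natM_or_add y m

theorem natM_le_natM (hM : IsQModel M) {a b : ℕ} : leM (natM M a) (natM M b) ↔ a ≤ b := by
  rw [hM.le_natM_iff]
  constructor
  · rintro ⟨i, hi, h⟩
    rwa [hM.natM_inj.1 h]
  · exact fun h => ⟨a, h, rfl⟩

theorem realize_term_natM (hM : IsQModel M) {k : ℕ} (t : LA.Term (Empty ⊕ Fin k)) (xs : Fin k → ℕ) :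
    t.realize (Sum.elim Empty.elim fun i => natM M (xs i)) =
      natM M (t.realize (Sum.elim Empty.elim xs)) := by
  induction t with
  | var x =>
    rcases x with x | x
    · exact x.elim
    · rfl
  | func g ts ih =>
    cases g with
    | zero => exact realize_func_zero _ _
    | succ => rw [realize_func_succ, ih]; rfl
    | add => rw [realize_func_add, ih, ih, hM.natM_add]; rfl
    | mul => rw [realize_func_mul, ih, ih, hM.natM_mul]; rfl

theorem realize_delta0 (hM : IsQModel M) {k : ℕ} {φ : LA.BoundedFormula Empty k} (h : Delta0 φ) (xs : Fin k → ℕ) :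
    φ.Realize (Empty.elim : Empty → M) (fun i => natM M (xs i)) ↔
      φ.Realize (Empty.elim : Empty → ℕ) xs := by
  induction h with
  | falsum => rfl
  | equal t₁ t₂ => simp only [realize_bdEqual, hM.realize_term_natM, hM.natM_inj]
  | le t₁ t₂ =>
    rw [realize_leF, hM.realize_term_natM, hM.realize_term_natM, hM.natM_le_natM]
    rfl
  | imp _ _ ih₁ ih₂ => simp only [realize_imp, ih₁, ih₂]
  | bdall t _ ih =>
    simp only [realize_all, realize_imp, realize_leF_last_nat, Nat.lt_succ_iff]
    constructor
    · intro H i hi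
      rw [← ih, ← natM_comp_snoc]
      refine H _ ((realize_leF_last _ _ _).2 ?_)
      rw [hM.realize_term_natM]
      exact hM.natM_le_natM.2 hi
    · intro H x hx
      have hx' := (realize_leF_last _ _ _).1 hx
      rw [hM.realize_term_natM] at hx'
      obtain ⟨i, hi, rfl⟩ := hM.le_natM_iff.1 hx'
      rw [natM_comp_snoc, ih]
      exact H i hi

end IsQModel

/-! ### Substitution of terms for the variables of a bounded formula -/

/-- Substitution of the terms `σ` in a term. -/
def instT {k l : ℕ} (σ : Fin k → LA.Term (Empty ⊕ Fin l)) (t : LA.Term (Empty ⊕ Fin k)) :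
    LA.Term (Empty ⊕ Fin l) :=
  t.subst (Sum.elim Empty.elim σ)

/-- Extension of a substitution to one more variable, which is kept. -/
def liftSub {k l : ℕ} (σ : Fin k → LA.Term (Empty ⊕ Fin l)) :
    Fin (k + 1) → LA.Term (Empty ⊕ Fin (l + 1)) :=
  Fin.snoc (fun i => liftT (σ i)) (&(Fin.last l))

/-- Simultaneous substitution of the terms `σ` for the variables of a formula. -/
def inst : ∀ {k l : ℕ}, (Fin k → LA.Term (Empty ⊕ Fin l)) → LA.BoundedFormula Empty k →
    LA.BoundedFormula Empty l
  | _, _, _, .falsum => .falsum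
  | _, _, σ, .equal t₁ t₂ => .equal (instT σ t₁) (instT σ t₂)
  | _, _, σ, .rel R ts => .rel R fun i => instT σ (ts i)
  | _, _, σ, .imp φ ψ => .imp (inst σ φ) (inst σ ψ)
  | _, _, σ, .all φ => .all (inst (liftSub σ) φ)

theorem realize_instT {M : Type} [LA.Structure M] {k l : ℕ}
    (σ : Fin k → LA.Term (Empty ⊕ Fin l)) (t : LA.Term (Empty ⊕ Fin k)) (xs : Fin l → M) :
    (instT σ t).realize (Sum.elim Empty.elim xs) =
      t.realize (Sum.elim Empty.elim fun i => (σ i).realize (Sum.elim Empty.elim xs)) := by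
  rw [instT, Term.realize_subst]
  congr 1
  funext i
  rcases i with i | i
  · exact i.elim
  · rfl

theorem realize_liftSub {M : Type} [LA.Structure M] {k l : ℕ}
    (σ : Fin k → LA.Term (Empty ⊕ Fin l)) (xs : Fin l → M) (x : M) :
    (fun i => (liftSub σ i).realize
      (Sum.elim Empty.elim (Fin.snoc xs x : Fin (l + 1) → M))) =
      (Fin.snoc (fun i => (σ i).realize (Sum.elim Empty.elim xs)) x : Fin (k + 1) → M) := by
  funext i
  refine Fin.lastCases ?_ (fun i => ?_) i
  · simp [liftSub]
  · simp only [liftSub, Fin.snoc_castSucc]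
    exact realize_liftT _ _ _

theorem realize_inst {M : Type} [LA.Structure M] {k l : ℕ}
    (σ : Fin k → LA.Term (Empty ⊕ Fin l)) (φ : LA.BoundedFormula Empty k) (xs : Fin l → M) :
    (inst σ φ).Realize (Empty.elim : Empty → M) xs ↔
      φ.Realize (Empty.elim : Empty → M) fun i => (σ i).realize (Sum.elim Empty.elim xs) := by
  induction φ generalizing l with
  | falsum => rfl
  | equal t₁ t₂ => simp only [inst, Realize, realize_instT]
  | rel R ts => simp only [inst, Realize, realize_instT]
  | imp φ ψ ih₁ ih₂ => simp only [inst, Realize, ih₁, ih₂]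
  | all φ ih => simp only [inst, Realize, ih, realize_liftSub]

theorem instT_liftT {k l : ℕ} (σ : Fin k → LA.Term (Empty ⊕ Fin l))
    (t : LA.Term (Empty ⊕ Fin k)) : instT (liftSub σ) (liftT t) = liftT (instT σ t) := by
  induction t with
  | var x =>
    rcases x with x | x
    · exact x.elim
    · simp [instT, liftT, liftSub]
  | func f ts ih =>
    simp only [instT, liftT, Term.relabel, Term.subst] at ih ⊢
    simp only [ih]

theorem inst_leF {k l : ℕ} (σ : Fin k → LA.Term (Empty ⊕ Fin l))
    (t s : LA.Term (Empty ⊕ Fin k)) : inst σ (leF t s) = leF (instT σ t) (instT σ s) := by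
  simp only [inst, leF]
  congr 1
  funext i
  fin_cases i <;> rfl

theorem Delta0.inst {k : ℕ} {φ : LA.BoundedFormula Empty k} (h : Delta0 φ) {l : ℕ}
    (σ : Fin k → LA.Term (Empty ⊕ Fin l)) : Delta0 (GRNonRE.inst σ φ) := by
  induction h generalizing l with
  | falsum => exact .falsum
  | equal t₁ t₂ => exact .equal _ _
  | le t₁ t₂ => rw [inst_leF]; exact .le _ _
  | imp _ _ ih₁ ih₂ => exact .imp (ih₁ σ) (ih₂ σ)
  | @bdall k t φ _ ih =>
    have : instT (liftSub σ) (&(Fin.last k)) = &(Fin.last l) := by simp [instT, liftSub]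
    simp only [GRNonRE.inst, inst_leF, instT_liftT, this]
    exact .bdall _ (ih _)

/-- The numerals of the numbers `xs`, as a substitution. -/
def numSub {k : ℕ} (xs : Fin k → ℕ) (i : Fin k) : LA.Term (Empty ⊕ Fin 0) :=
  (numeral (xs i)).relabel Sum.inl

theorem realize_numSub {M : Type} [LA.Structure M] {k : ℕ} (xs : Fin k → ℕ) (i : Fin k)
    (ys : Fin 0 → M) : (numSub xs i).realize (Sum.elim Empty.elim ys) = natM M (xs i) := by
  rw [numSub, Term.realize_relabel, realize_numeral]

/-! ### The hierarchy of formulas -/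

theorem Delta0.not {k : ℕ} {φ : LA.BoundedFormula Empty k} (h : Delta0 φ) : Delta0 (∼φ) :=
  .imp h .falsum

mutual

theorem IsSigma.succ {n k : ℕ} {φ : LA.BoundedFormula Empty k} (h : IsSigma n φ) :
    IsSigma (n + 1) φ := by
  match h with
  | .ofDelta0 h => exact .ofPi (.ofDelta0 h)
  | .ofPi h => exact .ofPi (IsPi.succ h)
  | .ex h => exact .ex (IsSigma.succ h)
  | .inf h₁ h₂ => exact .inf (IsSigma.succ h₁) (IsSigma.succ h₂)
  | .sup h₁ h₂ => exact .sup (IsSigma.succ h₁) (IsSigma.succ h₂)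
  | .bdall t h => exact .bdall t (IsSigma.succ h)

theorem IsPi.succ {n k : ℕ} {φ : LA.BoundedFormula Empty k} (h : IsPi n φ) :
    IsPi (n + 1) φ := by
  match h with
  | .ofDelta0 h => exact .ofSigma (.ofDelta0 h)
  | .ofSigma h => exact .ofSigma (IsSigma.succ h)
  | .all h => exact .all (IsPi.succ h)
  | .inf h₁ h₂ => exact .inf (IsPi.succ h₁) (IsPi.succ h₂)
  | .sup h₁ h₂ => exact .sup (IsPi.succ h₁) (IsPi.succ h₂)
  | .bdex t h => exact .bdex t (IsPi.succ h)

end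

theorem IsPi.mono {m n k : ℕ} {φ : LA.BoundedFormula Empty k} (h : IsPi m φ) (hmn : m ≤ n) :
    IsPi n φ := by
  induction hmn with
  | refl => exact h
  | step _ ih => exact ih.succ

/-- `DualPair n σ π`: `σ` is a prenex `Σₙ`-formula with single alternating quantifiers, and
`π` is the dual `Πₙ`-formula, equivalent to `∼σ`. -/
inductive DualPair : ℕ → ∀ {k : ℕ}, LA.BoundedFormula Empty k → LA.BoundedFormula Empty k → Prop
  | zero {k : ℕ} {δ : LA.BoundedFormula Empty k} : Delta0 δ → DualPair 0 δ (∼δ)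
  | succ {n k : ℕ} {σ π : LA.BoundedFormula Empty (k + 1)} :
      DualPair n σ π → DualPair (n + 1) π.ex σ.all

namespace DualPair

variable {n k : ℕ} {σ π : LA.BoundedFormula Empty k}

theorem isSigma_isPi (h : DualPair n σ π) : IsSigma n σ ∧ IsPi n π := by
  induction h with
  | zero h => exact ⟨.ofDelta0 h, .ofDelta0 h.not⟩
  | succ _ ih => exact ⟨.ex (.ofPi ih.2), .all (.ofSigma ih.1)⟩

theorem realize_iff_not (h : DualPair n σ π) {M : Type} [LA.Structure M] (w : Empty → M)
    (xs : Fin k → M) : π.Realize w xs ↔ ¬ σ.Realize w xs := by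
  induction h with
  | zero _ => exact realize_not
  | succ _ ih => simp [ih]

theorem inst (h : DualPair n σ π) {l : ℕ} (τ : Fin k → LA.Term (Empty ⊕ Fin l)) :
    DualPair n (inst τ σ) (inst τ π) := by
  induction h generalizing l with
  | zero h => exact .zero (h.inst τ)
  | succ _ ih => exact .succ (ih (liftSub τ))

end DualPair

/-! ### Provability of instances at numerals -/

theorem proves_iff {T : LA.Theory} {φ : LA.Sentence} :
    Proves T φ ↔ ∀ (M : Type) [LA.Structure M] [Nonempty M], M ⊨ T →
      BoundedFormula.Realize φ (Empty.elim : Empty → M) (fun i => i.elim0) := by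
  constructor
  · intro h M _ _ hM
    exact h (Theory.ModelType.of T M) _ _
  · intro h M v xs
    have := h M M.is_model
    rwa [Subsingleton.elim v Empty.elim, Subsingleton.elim xs fun i => i.elim0]

/-- `T` proves the instance of `φ` at the numerals of `xs`. -/
def ProvesAt (T : LA.Theory) {k : ℕ} (φ : LA.BoundedFormula Empty k) (xs : Fin k → ℕ) : Prop :=
  ∀ (M : Type) [LA.Structure M] [Nonempty M], M ⊨ T →
    φ.Realize (Empty.elim : Empty → M) fun i => natM M (xs i)

theorem proves_inst_numSub {T : LA.Theory} {k : ℕ} {φ : LA.BoundedFormula Empty k}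
    {xs : Fin k → ℕ} : Proves T (inst (numSub xs) φ) ↔ ProvesAt T φ xs := by
  rw [proves_iff, ProvesAt]
  refine forall_congr' fun M => forall_congr' fun _ => forall_congr' fun _ =>
    forall_congr' fun _ => ?_
  rw [realize_inst]
  simp only [realize_numSub]

theorem realize_subst1 {M : Type} [LA.Structure M] (ψ : LA.BoundedFormula Empty 1) (m : ℕ)
    (w : Empty → M) (xs : Fin 0 → M) :
    BoundedFormula.Realize (subst1 ψ m) w xs ↔
      ψ.Realize (Empty.elim : Empty → M) fun _ => natM M m := by
  rw [subst1, realize_subst, Subsingleton.elim xs default]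
  refine (realize_toFormula ψ _).trans (iff_of_eq ?_)
  congr 1
  · exact Subsingleton.elim _ _
  · funext i
    exact realize_numeral _ _

theorem isQModel_of_extendsQ {T : LA.Theory} (hQ : ExtendsQ T) {M : Type} [LA.Structure M]
    [Nonempty M] (hM : M ⊨ T) : IsQModel M := by
  refine isQModel_of_realize fun φ hφ => ?_
  have := proves_iff.1 (hQ φ hφ) M hM
  rwa [Sentence.Realize, Formula.Realize, Subsingleton.elim (default : Empty → M) Empty.elim,
    Subsingleton.elim (default : Fin 0 → M) fun i => i.elim0]

theorem NCon.consistent {n : ℕ} {T : LA.Theory} (h : NCon n T) : Consistent T := by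
  cases n with
  | zero => exact h
  | succ n =>
    intro hT
    have hall : ∀ φ : LA.Sentence, Proves T φ := fun φ =>
      proves_iff.2 fun M _ _ hM => (proves_iff.1 hT M hM).elim
    exact h ⟨⊥, (IsPi.ofDelta0 .falsum).mono n.zero_le, fun m => hall _, hall _⟩

/-- An `n`-consistent `Π_{n+1}`-deciding extension of `Q` proves all true `Σₙ`- and
`Πₙ`-sentences. -/
theorem DualPair.provesAt {n : ℕ} {T : LA.Theory} (hQ : ExtendsQ T) (hcon : NCon n T)
    (hdec : ∀ γ : LA.Sentence, IsPi (n + 1) γ → Proves T γ ∨ Proves T (∼γ))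
    {j k : ℕ} {σ π : LA.BoundedFormula Empty k} (h : DualPair j σ π) (hj : j ≤ n)
    (xs : Fin k → ℕ) :
    (σ.Realize (Empty.elim : Empty → ℕ) xs → ProvesAt T σ xs) ∧
      (π.Realize (Empty.elim : Empty → ℕ) xs → ProvesAt T π xs) := by
  induction h with
  | zero h =>
    exact ⟨fun hx M _ _ hM => ((isQModel_of_extendsQ hQ hM).realize_delta0 h xs).2 hx,
      fun hx M _ _ hM => ((isQModel_of_extendsQ hQ hM).realize_delta0 h.not xs).2 hx⟩
  | @succ j k σ π h ih =>
    constructor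
    · rw [realize_ex]
      rintro ⟨x, hx⟩ M _ _ hM
      refine realize_ex.2 ⟨natM M x, ?_⟩
      rw [natM_comp_snoc]
      exact (ih (by omega) _).2 hx M hM
    · intro hx
      have hx := realize_all.1 hx
      have hpi : IsPi (j + 1) (GRNonRE.inst (numSub xs) σ.all) :=
        (h.succ.inst (numSub xs)).isSigma_isPi.2
      rcases hdec _ (hpi.mono (by omega)) with hp | hp
      · exact proves_inst_numSub.1 hp
      · exfalso
        obtain ⟨m, rfl⟩ : ∃ m, n = m + 1 := ⟨n - 1, by omega⟩
        refine hcon ⟨GRNonRE.inst (liftSub (numSub xs)) π,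
          (h.inst _).isSigma_isPi.2.mono (by omega), fun y => ?_, ?_⟩
        · refine proves_iff.2 fun M _ _ hM => realize_not.2 ?_
          rw [realize_subst1, realize_inst, h.realize_iff_not, not_not]
          have := (ih (by omega) _).1 (hx y) M hM
          rw [← natM_comp_snoc] at this
          have e : (fun _ : Fin 1 => natM M y) =
              Fin.snoc (α := fun _ => M) (fun i : Fin 0 => i.elim0) (natM M y) := by
            funext i; fin_cases i; rfl
          rw [e, realize_liftSub]
          simpa only [realize_numSub] using this
        · refine proves_iff.2 fun M _ _ hM => ?_
          have := proves_iff.1 hp M hM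
          rw [realize_not, realize_inst, realize_all, not_forall] at this
          obtain ⟨x, hx⟩ := this
          refine realize_ex.2 ⟨x, ?_⟩
          rw [realize_inst, realize_liftSub, h.realize_iff_not]
          exact hx

/-! ### Relations definable by bounded formulas -/

/-- The function `F` is the value of a term. -/
def IsTermFun {k : ℕ} (F : (Fin k → ℕ) → ℕ) : Prop :=
  ∃ t : LA.Term (Empty ⊕ Fin k), ∀ v, t.realize (Sum.elim Empty.elim v) = F v

namespace IsTermFun

variable {k l : ℕ} {F G : (Fin k → ℕ) → ℕ}

theorem proj (i : Fin k) : IsTermFun fun v => v i := ⟨&i, fun _ => rfl⟩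

theorem last : IsTermFun fun v : Fin (k + 1) → ℕ => v (Fin.last k) := proj _

theorem const (m : ℕ) : IsTermFun fun _ : Fin k → ℕ => m :=
  ⟨(numeral m).relabel Sum.inl, fun v => by
    rw [Term.realize_relabel, realize_numeral, natM_nat]⟩

theorem add (hF : IsTermFun F) (hG : IsTermFun G) : IsTermFun fun v => F v + G v := by
  obtain ⟨t, ht⟩ := hF
  obtain ⟨s, hs⟩ := hG
  exact ⟨addT t s, fun v => by rw [realize_addT, ht, hs]; rfl⟩

theorem mul (hF : IsTermFun F) (hG : IsTermFun G) : IsTermFun fun v => F v * G v := by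
  obtain ⟨t, ht⟩ := hF
  obtain ⟨s, hs⟩ := hG
  exact ⟨mulT t s, fun v => by rw [realize_mulT, ht, hs]; rfl⟩

theorem comp (hF : IsTermFun F) {τ : Fin k → (Fin l → ℕ) → ℕ} (hτ : ∀ i, IsTermFun (τ i)) :
    IsTermFun fun v => F fun i => τ i v := by
  obtain ⟨t, ht⟩ := hF
  choose s hs using hτ
  exact ⟨instT s t, fun v => by
    beta_reduce
    rw [realize_instT, ← ht]
    simp only [hs]⟩

theorem init (hF : IsTermFun F) : IsTermFun fun v : Fin (k + 1) → ℕ => F (Fin.init v) :=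
  hF.comp fun i => proj i.castSucc

theorem snoc {f : Fin l → (Fin k → ℕ) → ℕ} (hf : ∀ i, IsTermFun (f i)) (hG : IsTermFun G)
    (i : Fin (l + 1)) :
    IsTermFun fun v => (Fin.snoc (fun j => f j v) (G v) : Fin (l + 1) → ℕ) i := by
  refine Fin.lastCases ?_ (fun i => ?_) i
  · simpa using hG
  · simpa using hf i

end IsTermFun

/-- The relation `R` is defined by a bounded formula. -/
def BoundedRel {k : ℕ} (R : (Fin k → ℕ) → Prop) : Prop :=
  ∃ δ : LA.BoundedFormula Empty k, Delta0 δ ∧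
    ∀ v, δ.Realize (Empty.elim : Empty → ℕ) v ↔ R v

namespace BoundedRel

variable {k l : ℕ} {R S : (Fin k → ℕ) → Prop} {F G : (Fin k → ℕ) → ℕ}

theorem eq (hF : IsTermFun F) (hG : IsTermFun G) : BoundedRel fun v => F v = G v := by
  obtain ⟨t, ht⟩ := hF
  obtain ⟨s, hs⟩ := hG
  exact ⟨t =' s, .equal _ _, fun v => by rw [realize_bdEqual, ht, hs]⟩

theorem le (hF : IsTermFun F) (hG : IsTermFun G) : BoundedRel fun v => F v ≤ G v := by
  obtain ⟨t, ht⟩ := hF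
  obtain ⟨s, hs⟩ := hG
  exact ⟨leF t s, .le _ _, fun v => by rw [realize_leF, ht, hs]; rfl⟩

theorem not (hR : BoundedRel R) : BoundedRel fun v => ¬ R v := by
  obtain ⟨δ, hδ, h⟩ := hR
  exact ⟨∼δ, hδ.not, fun v => by rw [realize_not, h]⟩

theorem and (hR : BoundedRel R) (hS : BoundedRel S) : BoundedRel fun v => R v ∧ S v := by
  obtain ⟨δ, hδ, h⟩ := hR
  obtain ⟨ε, hε, h'⟩ := hS
  exact ⟨δ ⊓ ε, (hδ.imp hε.not).not, fun v => by rw [realize_inf, h, h']⟩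

theorem or (hR : BoundedRel R) (hS : BoundedRel S) : BoundedRel fun v => R v ∨ S v := by
  obtain ⟨δ, hδ, h⟩ := hR
  obtain ⟨ε, hε, h'⟩ := hS
  exact ⟨δ ⊔ ε, hδ.not.imp hε, fun v => by rw [realize_sup, h, h']⟩

theorem comp (hR : BoundedRel R) {τ : Fin k → (Fin l → ℕ) → ℕ} (hτ : ∀ i, IsTermFun (τ i)) :
    BoundedRel fun v => R fun i => τ i v := by
  obtain ⟨δ, hδ, h⟩ := hR
  choose s hs using hτ
  exact ⟨inst s δ, hδ.inst s, fun v => by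
    beta_reduce
    rw [realize_inst, ← h]
    simp only [hs]⟩

theorem forall_le (hF : IsTermFun F) {P : (Fin k → ℕ) → ℕ → Prop}
    (hP : BoundedRel fun w : Fin (k + 1) → ℕ => P (Fin.init w) (w (Fin.last k))) :
    BoundedRel fun v => ∀ x ≤ F v, P v x := by
  obtain ⟨δ, hδ, h⟩ := hP
  obtain ⟨t, ht⟩ := hF
  refine ⟨_, .bdall t hδ, fun v => ?_⟩
  simp only [realize_all, realize_imp, realize_leF_last_nat, h, ht, Nat.lt_succ_iff,
    Fin.init_snoc, Fin.snoc_last]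

theorem exists_le (hF : IsTermFun F) {P : (Fin k → ℕ) → ℕ → Prop}
    (hP : BoundedRel fun w : Fin (k + 1) → ℕ => P (Fin.init w) (w (Fin.last k))) :
    BoundedRel fun v => ∃ x ≤ F v, P v x := by
  simpa using (forall_le hF (P := fun v x => ¬ P v x) hP.not).not

end BoundedRel

/-! ### Existential relations over bounded formulas -/

/-- The relation `R` is defined by a bounded formula preceded by one existential quantifier. -/
def ExRel {k : ℕ} (R : (Fin k → ℕ) → Prop) : Prop :=
  ∃ P : (Fin k → ℕ) → ℕ → Prop,
    BoundedRel (fun w : Fin (k + 1) → ℕ => P (Fin.init w) (w (Fin.last k))) ∧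
      ∀ v, R v ↔ ∃ x, P v x

namespace ExRel

variable {k l : ℕ} {R S : (Fin k → ℕ) → Prop}

theorem of_iff (h : ExRel R) (H : ∀ v, R v ↔ S v) : ExRel S := by
  obtain rfl : R = S := funext fun a => propext (H a)
  exact h

theorem of_bounded (hR : BoundedRel R) : ExRel R :=
  ⟨fun v _ => R v, hR.comp fun i => .proj i.castSucc, fun v => by simp⟩

theorem comp (hR : ExRel R) {τ : Fin k → (Fin l → ℕ) → ℕ} (hτ : ∀ i, IsTermFun (τ i)) :
    ExRel fun v => R fun i => τ i v := by
  obtain ⟨P, hP, h⟩ := hR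
  refine ⟨fun v x => P (fun i => τ i v) x, ?_, fun v => h _⟩
  have := hP.comp (IsTermFun.snoc (fun i => (hτ i).init) IsTermFun.last)
  simpa only [Fin.init_snoc, Fin.snoc_last] using this

theorem bounded_witness {P : (Fin k → ℕ) → ℕ → Prop}
    (hP : BoundedRel (fun w : Fin (k + 1) → ℕ => P (Fin.init w) (w (Fin.last k))))
    {τ : Fin k → (Fin l → ℕ) → ℕ} (hτ : ∀ i, IsTermFun (τ i)) {F : (Fin l → ℕ) → ℕ}
    (hF : IsTermFun F) : BoundedRel fun v => ∃ x ≤ F v, P (fun i => τ i v) x := by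
  refine .exists_le hF ?_
  have := hP.comp (IsTermFun.snoc (fun i => (hτ i).init) IsTermFun.last)
  simpa only [Fin.init_snoc, Fin.snoc_last] using this

theorem and (hR : ExRel R) (hS : ExRel S) : ExRel fun v => R v ∧ S v := by
  obtain ⟨P, hP, h⟩ := hR
  obtain ⟨P', hP', h'⟩ := hS
  refine ⟨fun v z => (∃ x ≤ z, P v x) ∧ ∃ x ≤ z, P' v x,
    (bounded_witness hP (fun i => .proj i.castSucc) .last).and
      (bounded_witness hP' (fun i => .proj i.castSucc) .last), fun v => ?_⟩
  beta_reduce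
  rw [h, h']
  constructor
  · rintro ⟨⟨x, hx⟩, y, hy⟩
    exact ⟨max x y, ⟨x, le_max_left _ _, hx⟩, y, le_max_right _ _, hy⟩
  · rintro ⟨z, ⟨x, -, hx⟩, y, -, hy⟩
    exact ⟨⟨x, hx⟩, y, hy⟩

theorem or (hR : ExRel R) (hS : ExRel S) : ExRel fun v => R v ∨ S v := by
  obtain ⟨P, hP, h⟩ := hR
  obtain ⟨P', hP', h'⟩ := hS
  exact ⟨fun v z => P v z ∨ P' v z, hP.or hP', fun v => by
    beta_reduce
    rw [h, h', exists_or]⟩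

theorem ex {P : (Fin k → ℕ) → ℕ → Prop}
    (hP : ExRel fun w : Fin (k + 1) → ℕ => P (Fin.init w) (w (Fin.last k))) :
    ExRel fun v => ∃ x, P v x := by
  obtain ⟨Q, hQ, h⟩ := hP
  refine ⟨fun v z => ∃ y ≤ z, ∃ x ≤ z, Q (Fin.snoc v y) x,
    .exists_le .last (bounded_witness hQ
      (IsTermFun.snoc (fun i => .proj i.castSucc.castSucc) .last) (IsTermFun.last.init)),
    fun v => ?_⟩
  have h (y : ℕ) : P v y ↔ ∃ x, Q (Fin.snoc v y) x := by
    have := h (Fin.snoc v y)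
    simpa only [Fin.init_snoc, Fin.snoc_last] using this
  simp only [h]
  constructor
  · rintro ⟨y, x, hx⟩
    exact ⟨max x y, y, le_max_right _ _, x, le_max_left _ _, hx⟩
  · rintro ⟨z, y, -, x, -, hx⟩
    exact ⟨y, x, hx⟩

theorem forall_le {F : (Fin k → ℕ) → ℕ} (hF : IsTermFun F) {P : (Fin k → ℕ) → ℕ → Prop}
    (hP : ExRel fun w : Fin (k + 1) → ℕ => P (Fin.init w) (w (Fin.last k))) :
    ExRel fun v => ∀ x ≤ F v, P v x := by
  obtain ⟨Q, hQ, h⟩ := hP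
  refine ⟨fun v z => ∀ y ≤ F v, ∃ x ≤ z, Q (Fin.snoc v y) x,
    .forall_le hF.init (bounded_witness hQ
      (IsTermFun.snoc (fun i => .proj i.castSucc.castSucc) .last) (IsTermFun.last.init)),
    fun v => ?_⟩
  have h (y : ℕ) : P v y ↔ ∃ x, Q (Fin.snoc v y) x := by
    have := h (Fin.snoc v y)
    simpa only [Fin.init_snoc, Fin.snoc_last] using this
  simp only [h]
  constructor
  · intro H
    choose! f hf using H
    exact ⟨(Finset.range (F v + 1)).sup f, fun y hy =>
      ⟨f y, Finset.le_sup (by simpa [Nat.lt_succ_iff] using hy), hf y hy⟩⟩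
  · rintro ⟨z, hz⟩ y hy
    obtain ⟨x, -, hx⟩ := hz y hy
    exact ⟨x, hx⟩

end ExRel

/-! ### Functions with existential graphs -/

/-- The graph of `F` is an existential relation. -/
def ExFun {k : ℕ} (F : (Fin k → ℕ) → ℕ) : Prop :=
  ExRel fun w : Fin (k + 1) → ℕ => w (Fin.last k) = F (Fin.init w)

namespace ExFun

variable {k l : ℕ} {F G : (Fin k → ℕ) → ℕ}

theorem of_term (hF : IsTermFun F) : ExFun F := .of_bounded (.eq .last hF.init)

theorem proj (i : Fin k) : ExFun fun v => v i := of_term (.proj i)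

theorem last : ExFun fun v : Fin (k + 1) → ℕ => v (Fin.last k) := proj _

theorem eq_term (hF : ExFun F) {τ : Fin k → (Fin l → ℕ) → ℕ} (hτ : ∀ i, IsTermFun (τ i))
    {H : (Fin l → ℕ) → ℕ} (hH : IsTermFun H) : ExRel fun v => H v = F fun i => τ i v := by
  have := ExRel.comp hF (IsTermFun.snoc hτ hH)
  simpa only [Fin.init_snoc, Fin.snoc_last] using this

theorem comp_term (hF : ExFun F) {τ : Fin k → (Fin l → ℕ) → ℕ} (hτ : ∀ i, IsTermFun (τ i)) :
    ExFun fun v => F fun i => τ i v :=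
  hF.eq_term (fun i => (hτ i).init) .last

theorem init (hF : ExFun F) : ExFun fun v : Fin (k + 1) → ℕ => F (Fin.init v) :=
  hF.comp_term fun i => .proj i.castSucc

end ExFun

theorem ExRel.subst {k : ℕ} {F : (Fin k → ℕ) → ℕ} (hF : ExFun F) {P : (Fin k → ℕ) → ℕ → Prop}
    (hP : ExRel fun w : Fin (k + 1) → ℕ => P (Fin.init w) (w (Fin.last k))) :
    ExRel fun v => P v (F v) :=
  (ExRel.ex (P := fun v x => x = F v ∧ P v x) (ExRel.and hF hP)).of_iff fun v => by simp

theorem ExRel.forall_lt {k : ℕ} {F : (Fin k → ℕ) → ℕ} (hF : ExFun F)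
    {P : (Fin k → ℕ) → ℕ → Prop}
    (hP : ExRel fun w : Fin (k + 1) → ℕ => P (Fin.init w) (w (Fin.last k))) :
    ExRel fun v => ∀ x < F v, P v x := by
  refine ExRel.subst (P := fun v y => ∀ x < y, P v x) hF ?_
  refine (ExRel.forall_le (F := fun w => w (Fin.last k)) .last
    (P := fun w x => w (Fin.last k) = x ∨ P (Fin.init w) x) ?_).of_iff fun w => ?_
  · refine (ExRel.of_bounded (.eq IsTermFun.last.init .last)).or ?_
    have := ExRel.comp hP
      (IsTermFun.snoc (fun i : Fin k => .proj i.castSucc.castSucc) (.last (k := k + 1)))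
    simp only [Fin.init_snoc, Fin.snoc_last] at this
    exact this
  · constructor
    · intro h x hx
      exact (h x hx.le).resolve_left hx.ne'
    · intro h x hx
      rcases hx.eq_or_lt with rfl | hx
      · exact .inl rfl
      · exact .inr (h x hx)

theorem ExRel.eq {k : ℕ} {F G : (Fin k → ℕ) → ℕ} (hF : ExFun F) (hG : ExFun G) :
    ExRel fun v => F v = G v :=
  ExRel.subst (P := fun v x => x = G v) hF hG

/-- The binary relation `R` holds between the values of functions with existential graphs. -/
theorem ExRel.comp₂ {k : ℕ} {R : ℕ → ℕ → Prop} (hR : ExRel fun v : Fin 2 → ℕ => R (v 0) (v 1))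
    {F G : (Fin k → ℕ) → ℕ} (hF : ExFun F) (hG : ExFun G) : ExRel fun v => R (F v) (G v) := by
  refine ExRel.subst (P := fun v x => R x (G v)) hF ?_
  refine ExRel.subst (P := fun w y => R (w (Fin.last k)) y) hG.init ?_
  exact ExRel.comp hR (τ := ![fun w => Fin.init w (Fin.last k), fun w => w (Fin.last (k + 1))])
    (by
      intro i
      fin_cases i
      · exact IsTermFun.last.init
      · exact IsTermFun.last)

namespace ExFun

variable {k : ℕ} {F G : (Fin k → ℕ) → ℕ}

theorem comp₁ {f : ℕ → ℕ} (hf : ExFun fun v : Fin 1 → ℕ => f (v 0)) (hF : ExFun F) :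
    ExFun fun v => f (F v) :=
  ExRel.comp₂ (R := fun y x => y = f x)
    (hf.eq_term (τ := fun _ v => v 1) (fun _ => .proj 1) (.proj 0)) last hF.init

theorem comp₂ {f : ℕ → ℕ → ℕ} (hf : ExFun fun v : Fin 2 → ℕ => f (v 0) (v 1)) (hF : ExFun F)
    (hG : ExFun G) : ExFun fun v => f (F v) (G v) := by
  refine ExRel.subst (P := fun w x => w (Fin.last k) = f x (G (Fin.init w))) hF.init ?_
  refine ExRel.subst (P := fun w y => w (Fin.last k).castSucc = f (w (Fin.last (k + 1))) y)
    hG.init.init ?_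
  exact hf.eq_term (τ := ![fun w => Fin.init w (Fin.last (k + 1)), fun w => w (Fin.last (k + 2))])
    (by
      intro i
      fin_cases i
      · exact IsTermFun.last.init
      · exact IsTermFun.last) (.proj _)

theorem pair (hF : ExFun F) (hG : ExFun G) : ExFun fun v => Nat.pair (F v) (G v) := by
  refine comp₂ (f := Nat.pair) (.of_bounded ?_) hF hG
  have h₀ : IsTermFun fun w : Fin 3 → ℕ => w 0 := .proj 0
  have h₁ : IsTermFun fun w : Fin 3 → ℕ => w 1 := .proj 1
  have h₂ : IsTermFun fun w : Fin 3 → ℕ => w 2 := .proj 2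
  obtain ⟨δ, hδ, h⟩ := ((BoundedRel.le (h₀.add (.const 1)) h₁).and
      (.eq h₂ ((h₁.mul h₁).add h₀))).or
    ((BoundedRel.le h₁ h₀).and (.eq h₂ (((h₀.mul h₀).add h₀).add h₁)))
  refine ⟨δ, hδ, fun w => (h w).trans ?_⟩
  change _ ↔ w 2 = Nat.pair (w 0) (w 1)
  rw [Nat.pair]
  split_ifs with hlt
  · simp [hlt, hlt.not_ge]
  · simp [hlt, not_lt.1 hlt]

theorem unpair_fst (hF : ExFun F) : ExFun fun v => (F v).unpair.1 := by
  refine comp₁ (f := fun x => x.unpair.1) ?_ hF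
  refine (ExRel.ex (P := fun w z => w 0 = Nat.pair (w 1) z) (ExRel.eq (proj 0)
    (pair (proj 1) (proj 2)))).of_iff fun w => ?_
  change _ ↔ w 1 = (w 0).unpair.1
  constructor
  · rintro ⟨z, h⟩
    simp [h]
  · intro h
    exact ⟨(w 0).unpair.2, by rw [h, Nat.pair_unpair]⟩

theorem unpair_snd (hF : ExFun F) : ExFun fun v => (F v).unpair.2 := by
  refine comp₁ (f := fun x => x.unpair.2) ?_ hF
  refine (ExRel.ex (P := fun w z => w 0 = Nat.pair z (w 1)) (ExRel.eq (proj 0)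
    (pair (proj 2) (proj 1)))).of_iff fun w => ?_
  change _ ↔ w 1 = (w 0).unpair.2
  constructor
  · rintro ⟨z, h⟩
    simp [h]
  · intro h
    exact ⟨(w 0).unpair.1, by rw [h, Nat.pair_unpair]⟩

theorem add (hF : ExFun F) (hG : ExFun G) : ExFun fun v => F v + G v :=
  comp₂ (f := (· + ·)) (of_term ((IsTermFun.proj 0).add (.proj 1))) hF hG

theorem mul (hF : ExFun F) (hG : ExFun G) : ExFun fun v => F v * G v :=
  comp₂ (f := (· * ·)) (of_term ((IsTermFun.proj 0).mul (.proj 1))) hF hG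

theorem mod_succ (hF : ExFun F) (hG : ExFun G) : ExFun fun v => F v % (G v + 1) := by
  refine comp₂ (f := fun x y => x % (y + 1)) ?_ hF hG
  refine (ExRel.and (.of_bounded (.le (.proj 2) (.proj 1)))
    (ExRel.ex (P := fun w q => w 0 = (w 1 + 1) * q + w 2)
      (.of_bounded (.eq (.proj 0) (.add (.mul (.add (.proj 1) (.const 1)) (.proj 3))
        (.proj 2)))))).of_iff fun w => ?_
  change _ ↔ w 2 = w 0 % (w 1 + 1)
  constructor
  · rintro ⟨hle, q, hq⟩
    rw [hq, Nat.mul_add_mod, Nat.mod_eq_of_lt (Nat.lt_succ_of_le hle)]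
  · intro h
    refine ⟨?_, w 0 / (w 1 + 1), ?_⟩
    · rw [h]
      exact Nat.lt_succ_iff.1 (Nat.mod_lt _ (Nat.succ_pos _))
    · rw [h, Nat.div_add_mod]

theorem beta (hF : ExFun F) (hG : ExFun G) : ExFun fun v => Nat.beta (F v) (G v) :=
  mod_succ hF.unpair_fst ((hG.add (of_term (.const 1))).mul hF.unpair_snd)

end ExFun

theorem rec_iff_beta (a : ℕ) (g : ℕ → ℕ → ℕ) (n y : ℕ) :
    y = Nat.rec (motive := fun _ => ℕ) a g n ↔
      ∃ c, Nat.beta c 0 = a ∧ (∀ i < n, Nat.beta c (i + 1) = g i (Nat.beta c i)) ∧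
        y = Nat.beta c n := by
  constructor
  · intro h
    set r : ℕ → ℕ := fun i => Nat.rec (motive := fun _ => ℕ) a g i with hr
    refine ⟨Nat.unbeta ((List.range (n + 1)).map r), ?_⟩
    have key (i : ℕ) (hi : i ≤ n) :
        Nat.beta (Nat.unbeta ((List.range (n + 1)).map r)) i = r i := by
      have := Nat.beta_unbeta_coe ((List.range (n + 1)).map r)
        ⟨i, by simpa [Nat.lt_succ_iff] using hi⟩
      simpa using this
    refine ⟨key 0 n.zero_le, fun i hi => ?_, ?_⟩
    · rw [key _ hi, key _ hi.le]
    · rw [key _ le_rfl, h]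
  · rintro ⟨c, h0, hs, rfl⟩
    have key (i : ℕ) (hi : i ≤ n) : Nat.beta c i = Nat.rec (motive := fun _ => ℕ) a g i := by
      induction i with
      | zero => exact h0
      | succ i ih => rw [hs i hi, ih (by omega)]
    exact key n le_rfl

theorem ExFun.of_primrec {f : ℕ → ℕ} (hf : Nat.Primrec f) :
    ExFun fun v : Fin 1 → ℕ => f (v 0) := by
  induction hf with
  | zero => exact of_term (.const 0)
  | succ => exact of_term ((IsTermFun.proj 0).add (.const 1))
  | left => exact (proj 0).unpair_fst
  | right => exact (proj 0).unpair_snd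
  | pair _ _ ih₁ ih₂ => exact ih₁.pair ih₂
  | comp _ _ ih₁ ih₂ => exact ih₁.comp₁ ih₂
  | @prec f g _ _ ihf ihg =>
    have x₂ : ExFun fun v : Fin 3 → ℕ => v 0 := proj 0
    have c₂ : ExFun fun v : Fin 3 → ℕ => v 2 := proj 2
    have x₃ : ExFun fun v : Fin 4 → ℕ => v 0 := proj 0
    have c₃ : ExFun fun v : Fin 4 → ℕ => v 2 := proj 2
    have i₃ : ExFun fun v : Fin 4 → ℕ => v 3 := proj 3
    refine (ExRel.ex (P := fun w c => Nat.beta c 0 = f (w 0).unpair.1 ∧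
      (∀ i < (w 0).unpair.2, Nat.beta c (i + 1) =
        g (Nat.pair (w 0).unpair.1 (Nat.pair i (Nat.beta c i)))) ∧
      w 1 = Nat.beta c (w 0).unpair.2) ?_).of_iff fun w => (rec_iff_beta (f (w 0).unpair.1)
        (fun i r => g (Nat.pair (w 0).unpair.1 (Nat.pair i r))) _ _).symm
    refine (ExRel.eq (c₂.beta (of_term (.const 0))) (ihf.comp₁ x₂.unpair_fst)).and
      (ExRel.and ?_ (ExRel.eq (proj 1) (c₂.beta x₂.unpair_snd)))
    exact ExRel.forall_lt (F := fun v : Fin 3 → ℕ => (v 0).unpair.2)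
      (P := fun v i => Nat.beta (v 2) (i + 1) =
        g (Nat.pair (v 0).unpair.1 (Nat.pair i (Nat.beta (v 2) i)))) x₂.unpair_snd
      (ExRel.eq (c₃.beta (i₃.add (of_term (.const 1))))
        (ihg.comp₁ (x₃.unpair_fst.pair (i₃.pair (c₃.beta i₃)))))

/-! ### Prenex formulas for predicates of the hierarchy -/

theorem ExRel.exists_dualPair {k : ℕ} {R : (Fin k → ℕ) → Prop} (h : ExRel R) :
    ∃ σ π : LA.BoundedFormula Empty k, DualPair 1 σ π ∧
      ∀ v, σ.Realize (Empty.elim : Empty → ℕ) v ↔ R v := by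
  obtain ⟨P, ⟨δ, hδ, hP⟩, h⟩ := h
  refine ⟨_, _, .succ (.zero hδ.not), fun v => ?_⟩
  simp only [realize_ex, realize_not, not_not, hP, h, Fin.init_snoc, Fin.snoc_last]

theorem SigmaPred.exists_dualPair {n : ℕ} {α : Type} [Primcodable α] {R : α → Prop}
    (hR : SigmaPred (n + 1) R) {k : ℕ} {g : (Fin k → ℕ) → α}
    (hg : ExFun fun v => Encodable.encode (g v)) :
    ∃ σ π : LA.BoundedFormula Empty k, DualPair (n + 1) σ π ∧
      ∀ v, σ.Realize (Empty.elim : Empty → ℕ) v ↔ R (g v) := by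
  induction n generalizing α k with
  | zero =>
    obtain ⟨P, ⟨_, hP⟩, h⟩ := hR
    refine ExRel.exists_dualPair ?_
    refine (ExRel.ex (P := fun v y =>
      Encodable.encode ((Encodable.decode (α := α × ℕ)
        (Nat.pair (Encodable.encode (g v)) y)).map fun p => decide (P p)) = 1)
      (ExRel.eq ((ExFun.of_primrec hP).comp₁ (f := fun m => Encodable.encode
        ((Encodable.decode (α := α × ℕ) m).map fun p => decide (P p))) (hg.init.pair .last))
        (.of_term (.const 1)))).of_iff fun v => ?_
    rw [h]
    refine exists_congr fun y => ?_
    have : Nat.pair (Encodable.encode (g v)) y = Encodable.encode (g v, y) := rfl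
    rw [this, Encodable.encodek]
    by_cases hp : P (g v, y) <;> simp [hp]
  | succ n ih =>
    obtain ⟨P, hP, h⟩ := hR
    obtain ⟨σ, π, hd, hσ⟩ := ih hP (k := k + 1) (g := fun w => (g (Fin.init w), w (Fin.last k)))
      (hg.init.pair .last)
    refine ⟨_, _, hd.succ, fun v => ?_⟩
    simp only [realize_ex, hd.realize_iff_not, hσ, h, Fin.init_snoc, Fin.snoc_last]

section Codes

open Nat.Partrec (Code)

/-! ### Formulas represented by trees

Terms and formulas of arithmetic are represented by elements of `Nat.Partrec.Code`, used as a
type of binary trees on which recursion is known to be primitive recursive. -/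

/-- The term in `k` variables represented by a tree. -/
def termOf (k : ℕ) : Code → LA.Term (Empty ⊕ Fin k)
  | .rfind' t => succT (termOf k t)
  | .pair s t => addT (termOf k s) (termOf k t)
  | .comp s t => mulT (termOf k s) (termOf k t)
  | .prec a _ => if h : Encodable.encode a < k then &⟨Encodable.encode a, h⟩ else zeroT
  | _ => zeroT

/-- The atomic formula in `k` variables represented by a tree. -/
def atomOf (k : ℕ) : Code → LA.BoundedFormula Empty k
  | .pair s t => termOf k s =' termOf k t
  | .comp s t => leF (termOf k s) (termOf k t)
  | _ => ⊥

/-- The formula in `k` variables represented by a tree. -/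
def formulaOf : (k : ℕ) → Code → LA.BoundedFormula Empty k
  | k, .pair _ b => atomOf k b
  | k, .prec a b => formulaOf k a ⟹ formulaOf k b
  | k, .rfind' a => (formulaOf (k + 1) a).all
  | _, _ => ⊥

/-- The value is `k + 1` if the tree is a well-formed representation of a formula
in `k` variables. -/
def codeCtx : Code → ℕ
  | .pair a _ => Encodable.encode a + 1
  | .prec a b => if codeCtx a = codeCtx b then codeCtx a else 0
  | .rfind' a => codeCtx a - 1
  | _ => 0

theorem exists_termOf {k : ℕ} (t : LA.Term (Empty ⊕ Fin k)) : ∃ c, termOf k c = t := by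
  induction t with
  | var x =>
    rcases x with x | i
    · exact x.elim
    · exact ⟨.prec (Denumerable.ofNat Code i) .zero, by simp [termOf]⟩
  | @func l f ts ih =>
    choose c hc using ih
    cases f with
    | zero => exact ⟨.zero, congrArg (Term.func _) (funext fun i => i.elim0)⟩
    | succ =>
      exact ⟨.rfind' (c 0), congrArg (Term.func _) (funext fun i => by fin_cases i; exact hc 0)⟩
    | add =>
      exact ⟨.pair (c 0) (c 1), congrArg (Term.func _) (funext fun i => by
        fin_cases i
        exacts [hc 0, hc 1])⟩
    | mul =>
      exact ⟨.comp (c 0) (c 1), congrArg (Term.func _) (funext fun i => by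
        fin_cases i
        exacts [hc 0, hc 1])⟩

theorem exists_formulaOf {k : ℕ} (φ : LA.BoundedFormula Empty k) :
    ∃ c, codeCtx c = k + 1 ∧ formulaOf k c = φ := by
  induction φ with
  | @falsum k => exact ⟨.pair (Denumerable.ofNat Code k) .zero, by simp [codeCtx], rfl⟩
  | @equal k s t =>
    obtain ⟨a, rfl⟩ := exists_termOf s
    obtain ⟨b, rfl⟩ := exists_termOf t
    exact ⟨.pair (Denumerable.ofNat Code k) (.pair a b), by simp [codeCtx], rfl⟩
  | @rel k l R ts =>
    cases R
    obtain ⟨a, ha⟩ := exists_termOf (ts 0)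
    obtain ⟨b, hb⟩ := exists_termOf (ts 1)
    refine ⟨.pair (Denumerable.ofNat Code k) (.comp a b), by simp [codeCtx],
      congrArg (BoundedFormula.rel _) (funext fun i => ?_)⟩
    fin_cases i
    exacts [ha, hb]
  | imp _ _ ih₁ ih₂ =>
    obtain ⟨a, ha, rfl⟩ := ih₁
    obtain ⟨b, hb, rfl⟩ := ih₂
    exact ⟨.prec a b, by simp [codeCtx, ha, hb], rfl⟩
  | all _ ih =>
    obtain ⟨a, ha, rfl⟩ := ih
    exact ⟨.rfind' a, by simp [codeCtx, ha], rfl⟩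

/-! ### Gödel numbers of represented formulas -/

/-- The symbols of a represented term, as numbers. -/
def termTokens (k : ℕ) : Code → List ℕ
  | .rfind' t => 3 :: termTokens k t
  | .pair s t => 5 :: (termTokens k s ++ termTokens k t)
  | .comp s t => 7 :: (termTokens k s ++ termTokens k t)
  | .prec a _ => if Encodable.encode a < k then [2 * (2 * Encodable.encode a + 1)] else [1]
  | _ => [1]

/-- The symbol standing for a term inside a formula. -/
def termToken (k : ℕ) (t : Code) : ℕ := 2 * Nat.pair k (Encodable.encode (termTokens k t))

/-- The symbols of a represented atomic formula, as numbers. -/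
def atomTokens (k : ℕ) : Code → List ℕ
  | .pair s t => [termToken k s, termToken k t]
  | .comp s t => [1, 2 * (2 * k + 1) + 1, termToken k s, termToken k t]
  | _ => [2 * (2 * (k + 2) + 1) + 1]

/-- The symbols of a represented formula, as numbers. -/
def formulaTokens : Code → List ℕ
  | .pair a b => atomTokens (Encodable.encode a) b
  | .prec a b => 3 :: (formulaTokens a ++ formulaTokens b)
  | .rfind' a => 7 :: formulaTokens a
  | _ => []

theorem encode_map_encode {α : Type} [Encodable α] (l : List α) :
    Encodable.encode (l.map Encodable.encode) = Encodable.encode l := by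
  induction l with
  | nil => rfl
  | cons a l ih => rw [List.map_cons, Encodable.encode_list_cons, Encodable.encode_list_cons, ih,
      Encodable.encode_nat]

theorem map_encode_listEncode_termOf (k : ℕ) (c : Code) :
    (termOf k c).listEncode.map Encodable.encode = termTokens k c := by
  induction c with
  | zero | succ | left | right => rfl
  | pair s t hs ht =>
    rw [termTokens, ← hs, ← ht]
    simp [termOf, addT, Term.listEncode, List.finRange_succ]
    rfl
  | comp s t hs ht =>
    rw [termTokens, ← hs, ← ht]
    simp [termOf, mulT, Term.listEncode, List.finRange_succ]
    rfl
  | rfind' t ht =>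
    rw [termTokens, ← ht]
    simp [termOf, succT, Term.listEncode, List.finRange_succ]
    rfl
  | prec a b _ _ =>
    rw [termOf, termTokens]
    split_ifs
    · rfl
    · rfl

theorem encode_sigma_termOf (k : ℕ) (c : Code) :
    Encodable.encode (Sum.inl ⟨k, termOf k c⟩ :
      (Σ k, LA.Term (Empty ⊕ Fin k)) ⊕ ((Σ n, LA.Relations n) ⊕ ℕ)) = termToken k c := by
  rw [termToken, ← map_encode_listEncode_termOf, encode_map_encode]
  rfl

theorem map_encode_listEncode_formulaOf {k : ℕ} {c : Code} (h : codeCtx c = k + 1) :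
    (formulaOf k c).listEncode.map Encodable.encode = formulaTokens c := by
  induction c generalizing k with
  | zero | succ | left | right | comp => simp [codeCtx] at h
  | pair a b =>
    obtain rfl : Encodable.encode a = k := by simpa [codeCtx] using h
    rw [formulaOf, formulaTokens]
    cases b with
    | pair s t =>
      simp only [atomOf, atomTokens, ← encode_sigma_termOf]
      rfl
    | comp s t =>
      simp only [atomOf, atomTokens, ← encode_sigma_termOf]
      simp [leF, listEncode, List.finRange_succ]
      rfl
    | _ => rfl
  | prec a b iha ihb =>
    rw [codeCtx] at h
    split_ifs at h with hab
    rw [formulaTokens, ← iha h, ← ihb (hab ▸ h)]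
    simp [formulaOf, listEncode]
  | rfind' a iha =>
    rw [formulaTokens, ← iha (k := k + 1) (by rw [codeCtx] at h; omega)]
    simp [formulaOf, listEncode]

theorem godel_formulaOf {k : ℕ} {c : Code} (h : codeCtx c = k + 1) :
    godel (formulaOf k c) = Encodable.encode (formulaTokens c) := by
  rw [← map_encode_listEncode_formulaOf h, encode_map_encode, godel]

theorem godel_injective {k : ℕ} :
    Function.Injective (godel : LA.BoundedFormula Empty k → ℕ) := by
  intro φ ψ h
  have := BoundedFormula.listEncode_sigma_injective (L := LA) (α := Empty)
    (a₁ := ⟨k, φ⟩) (a₂ := ⟨k, ψ⟩) (Encodable.encode_injective h)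
  simpa using this

theorem mem_axiomCodes_iff {T : LA.Theory} {c : Code} (h : codeCtx c = 1) :
    Encodable.encode (formulaTokens c) ∈ axiomCodes T ↔ formulaOf 0 c ∈ T := by
  rw [← godel_formulaOf h]
  constructor
  · rintro ⟨φ, hφ, h⟩
    exact godel_injective h ▸ hφ
  · intro h
    exact ⟨_, h, rfl⟩

section Primrec

variable {α : Type} [Primcodable α]

open Primrec Nat.Partrec.Code

theorem primrec_codeCtx : Primrec codeCtx := by
  refine (primrec_recOn (α := Code) (c := id) .id (z := fun _ => 0) (.const 0)
    (s := fun _ => 0) (.const 0) (l := fun _ => 0) (.const 0) (r := fun _ => 0) (.const 0)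
    (pr := fun _ a _ _ _ => Encodable.encode a + 1) ?_
    (co := fun _ _ _ _ _ => 0) (.const 0)
    (pc := fun _ _ _ x y => if x = y then x else 0) ?_
    (rf := fun _ _ x => x - 1) ?_).of_eq fun c => ?_
  · exact Primrec.succ.comp (Primrec.encode.comp (fst.comp snd))
  · have x : Primrec fun a : Code × Code × Code × ℕ × ℕ => a.2.2.2.1 :=
      fst.comp (snd.comp (snd.comp snd))
    exact Primrec.ite (Primrec.eq.comp x (snd.comp (snd.comp (snd.comp snd)))) x (.const 0)
  · exact Primrec.pred.comp (snd.comp snd)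
  · induction c <;> simp_all [codeCtx]

theorem primrec_termTokens : Primrec₂ termTokens := by
  have app : Primrec fun a : (ℕ × Code) × Code × Code × List ℕ × List ℕ =>
      a.2.2.2.1 ++ a.2.2.2.2 :=
    list_append.comp (fst.comp (snd.comp (snd.comp snd))) (snd.comp (snd.comp (snd.comp snd)))
  have a : Primrec fun a : (ℕ × Code) × Code × Code × List ℕ × List ℕ =>
      Encodable.encode a.2.1 := Primrec.encode.comp (fst.comp snd)
  have pc : Primrec fun a : (ℕ × Code) × Code × Code × List ℕ × List ℕ =>
      if Encodable.encode a.2.1 < a.1.1 then [2 * (2 * Encodable.encode a.2.1 + 1)] else [1] :=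
    Primrec.ite (nat_lt.comp a (fst.comp fst))
      (list_cons.comp (nat_double.comp (nat_double_succ.comp a)) (.const _)) (.const _)
  have h := primrec_recOn (α := ℕ × Code) (σ := List ℕ) (c := Prod.snd) snd
    (z := fun _ => [1]) (.const _)
    (s := fun _ => [1]) (.const _) (l := fun _ => [1]) (.const _) (r := fun _ => [1]) (.const _)
    (pr := fun _ _ _ x y => 5 :: (x ++ y)) (list_cons.comp (.const _) app)
    (co := fun _ _ _ x y => 7 :: (x ++ y)) (list_cons.comp (.const _) app)
    (pc := fun p a _ _ _ => if Encodable.encode a < p.1 then [2 * (2 * Encodable.encode a + 1)]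
      else [1]) pc
    (rf := fun _ _ x => 3 :: x) (list_cons.comp (.const _) (snd.comp snd))
  refine Primrec.of_eq h fun p => ?_
  obtain ⟨k, c⟩ := p
  change _ = termTokens k c
  induction c with
  | prec => rfl
  | zero | succ | left | right => rfl
  | _ => simp_all [termTokens]

theorem primrec_termToken : Primrec₂ termToken :=
  nat_double.comp (Primrec₂.natPair.comp fst (Primrec.encode.comp primrec_termTokens))

theorem primrec_atomTokens : Primrec₂ atomTokens := by
  have k : Primrec fun a : (ℕ × Code) × Code × Code × List ℕ × List ℕ => a.1.1 := fst.comp fst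
  have s : Primrec fun a : (ℕ × Code) × Code × Code × List ℕ × List ℕ =>
      termToken a.1.1 a.2.1 := primrec_termToken.comp k (fst.comp snd)
  have t : Primrec fun a : (ℕ × Code) × Code × Code × List ℕ × List ℕ =>
      termToken a.1.1 a.2.2.1 := primrec_termToken.comp k (fst.comp (snd.comp snd))
  have st := list_cons.comp s (list_cons.comp t (.const []))
  have f : Primrec fun p : ℕ × Code => [2 * (2 * (p.1 + 2) + 1) + 1] :=
    list_cons.comp (nat_double_succ.comp (nat_double_succ.comp
      (Primrec.succ.comp (Primrec.succ.comp fst)))) (.const [])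
  refine (primrec_recOn (α := ℕ × Code) (c := Prod.snd) snd f f f f
    (pr := fun p a b _ _ => [termToken p.1 a, termToken p.1 b]) st
    (co := fun p a b _ _ => [1, 2 * (2 * p.1 + 1) + 1, termToken p.1 a, termToken p.1 b])
    (list_cons.comp (.const 1) (list_cons.comp (nat_double_succ.comp (nat_double_succ.comp k)) st))
    (pc := fun p _ _ _ _ => [2 * (2 * (p.1 + 2) + 1) + 1]) (f.comp fst)
    (rf := fun p _ _ => [2 * (2 * (p.1 + 2) + 1) + 1]) (f.comp fst)).of_eq fun p => ?_
  obtain ⟨k, c⟩ := p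
  cases c <;> rfl

theorem primrec_formulaTokens : Primrec formulaTokens := by
  refine (primrec_recOn (α := Code) (c := id) .id (z := fun _ => []) (.const _)
    (s := fun _ => []) (.const _) (l := fun _ => []) (.const _) (r := fun _ => []) (.const _)
    (pr := fun _ a b _ _ => atomTokens (Encodable.encode a) b)
    (primrec_atomTokens.comp (Primrec.encode.comp (fst.comp snd)) (fst.comp (snd.comp snd)))
    (co := fun _ _ _ _ _ => []) (.const _)
    (pc := fun _ _ _ x y => 3 :: (x ++ y))
    (list_cons.comp (.const _) (list_append.comp (fst.comp (snd.comp (snd.comp snd)))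
      (snd.comp (snd.comp (snd.comp snd)))))
    (rf := fun _ _ x => 7 :: x) (list_cons.comp (.const _) (snd.comp snd))).of_eq fun c => ?_
  induction c <;> simp_all [formulaTokens]

end Primrec

/-! ### Truth of represented formulas -/

section Semantics

variable {M : Type} [LA.Structure M]

/-- The represented formula is true in `M` when its variables take the listed values. -/
def Holds (c : Code) (l : List M) : Prop :=
  (formulaOf l.length c).Realize (Empty.elim : Empty → M) fun i => l.getD i (zeroM M)

theorem holds_imp (a b : Code) (l : List M) :
    Holds (.prec a b) l ↔ (Holds a l → Holds b l) := by
  rw [Holds, formulaOf, realize_imp, Holds, Holds]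

theorem realize_formulaOf_snoc (a : Code) (l : List M) (x : M) :
    (formulaOf (l.length + 1) a).Realize (Empty.elim : Empty → M)
      (Fin.snoc (fun i : Fin l.length => l.getD i (zeroM M)) x) ↔ Holds a (l ++ [x]) := by
  have h {k : ℕ} (hk : k = l.length + 1) :
      (formulaOf (l.length + 1) a).Realize (Empty.elim : Empty → M)
        (Fin.snoc (fun i : Fin l.length => l.getD i (zeroM M)) x) ↔
      (formulaOf k a).Realize (Empty.elim : Empty → M)
        fun i => (l ++ [x]).getD i (zeroM M) := by
    subst hk
    refine iff_of_eq (congrArg _ (funext fun i => ?_))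
    refine Fin.lastCases ?_ (fun i => ?_) i
    · simp
    · simp only [Fin.snoc_castSucc, Fin.val_castSucc]
      rw [List.getD_append _ _ _ _ i.2]
  exact h (by simp)

theorem holds_all (a : Code) (l : List M) :
    Holds (.rfind' a) l ↔ ∀ x, Holds a (l ++ [x]) := by
  rw [Holds, formulaOf, realize_all]
  exact forall_congr' fun x => realize_formulaOf_snoc a l x

/-- The value of a represented term, with trees in place of the values of variables. -/
def elemOf (env : List Code) : Code → Code
  | .rfind' t => .rfind' (elemOf env t)
  | .pair s t => .pair (elemOf env s) (elemOf env t)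
  | .comp s t => .comp (elemOf env s) (elemOf env t)
  | .prec a _ => env.getD (Encodable.encode a) .zero
  | _ => .zero

/-- The map `h` interprets trees as elements of `M`, compatibly with the operations. -/
structure IsInterp (h : Code → M) : Prop where
  zero : h .zero = zeroM M
  succ (x : Code) : h (.rfind' x) = succM (h x)
  add (x y : Code) : h (.pair x y) = addM (h x) (h y)
  mul (x y : Code) : h (.comp x y) = mulM (h x) (h y)

/-- The tree interpreted as the numeral of a number. -/
def numCode (m : ℕ) : Code := m.rec .zero fun _ c => .rfind' c

/-- A tree representing the equality of the first two variables. -/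
def eqCode : Code := .pair .zero (.pair (.prec .zero .zero) (.prec .succ .zero))

/-- A tree representing the inequality between the first two variables. -/
def leCode : Code := .pair .zero (.comp (.prec .zero .zero) (.prec .succ .zero))

variable {h : Code → M}

theorem IsInterp.getD_map (hh : IsInterp h) (env : List Code) (i : ℕ) :
    (env.map h).getD i (zeroM M) = h (env.getD i .zero) := by
  rw [← hh.zero, List.getD_map]

theorem IsInterp.numCode (hh : IsInterp h) (m : ℕ) : h (numCode m) = natM M m := by
  induction m with
  | zero => exact hh.zero
  | succ m ih => exact (hh.succ _).trans (congrArg succM ih)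

theorem IsInterp.realize_termOf (hh : IsInterp h) (env : List Code) (t : Code) :
    (termOf (env.map h).length t).realize (Sum.elim (Empty.elim : Empty → M)
      fun i : Fin (env.map h).length => (env.map h).getD i (zeroM M)) = h (elemOf env t) := by
  induction t with
  | zero | succ | left | right => exact (realize_zeroT _).trans hh.zero.symm
  | pair s t hs ht => rw [termOf, realize_addT, hs, ht, elemOf, hh.add]
  | comp s t hs ht => rw [termOf, realize_mulT, hs, ht, elemOf, hh.mul]
  | rfind' t ht => rw [termOf, realize_succT, ht, elemOf, hh.succ]
  | prec a b =>
    rw [termOf, elemOf]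
    split_ifs with ha
    · exact hh.getD_map env _
    · rw [realize_zeroT, ← hh.zero, List.getD_eq_default]
      simpa using ha

theorem IsInterp.holds_eq (hh : IsInterp h) (a s t : Code) (env : List Code) :
    Holds (.pair a (.pair s t)) (env.map h) ↔ h (elemOf env s) = h (elemOf env t) := by
  rw [Holds, formulaOf, atomOf, realize_bdEqual, hh.realize_termOf, hh.realize_termOf]

theorem IsInterp.holds_le (hh : IsInterp h) (a s t : Code) (env : List Code) :
    Holds (.pair a (.comp s t)) (env.map h) ↔ leM (h (elemOf env s)) (h (elemOf env t)) := by
  rw [Holds, formulaOf, atomOf, realize_leF, hh.realize_termOf, hh.realize_termOf]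

theorem IsInterp.holds_eqCode (hh : IsInterp h) (x y : Code) : Holds eqCode [h x, h y] ↔ h x = h y :=
  hh.holds_eq _ _ _ [x, y]

theorem IsInterp.holds_leCode (hh : IsInterp h) (x y : Code) : Holds leCode [h x, h y] ↔ leM (h x) (h y) :=
  hh.holds_le _ _ _ [x, y]

end Semantics

/-! ### Clauses describing Henkin models -/

/-- A tree encoding a list of trees. -/
def listCode (env : List Code) : Code := env.foldr .pair .zero

/-- The element chosen as a counterexample to the universal closure of the formula `a` in its
last variable, the other variables being given by `env`. -/
def witness (a : Code) (env : List Code) : Code := .prec a (listCode env)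

/-- Instances of represented formulas, serving as propositional variables. -/
abbrev Instance : Type := Code × List Code

/-- Disjunctions of literals. -/
abbrev Clause : Type := List (Instance × Bool)

/-- The valuation `v` satisfies the clause `C`. -/
def Sat (v : Instance → Prop) (C : Clause) : Prop := ∃ l ∈ C, (v l.1 ↔ l.2 = true)

/-- Clauses stating the equivalence of two instances. -/
def iffClauses (i j : Instance) : List Clause :=
  [ [(i, false), (j, true)], [(i, true), (j, false)] ]

/-- Clauses for implications. -/
def impClauses (a b : Code) (env : List Code) : List Clause :=
  [ [((.prec a b, env), false), ((a, env), false), ((b, env), true)],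
    [((.prec a b, env), true), ((a, env), true)],
    [((.prec a b, env), true), ((b, env), false)] ]

/-- Clauses for universal quantifiers. -/
def allClauses (a : Code) (env : List Code) (x : Code) : List Clause :=
  [ [((.rfind' a, env), false), ((a, env ++ [x]), true)],
    [((.rfind' a, env), true), ((a, env ++ [witness a env]), false)] ]

/-- Clauses for atomic formulas. -/
def atomClauses (a : Code) (env : List Code) : Code → List Clause
  | .pair s t => iffClauses (.pair a (.pair s t), env) (eqCode, [elemOf env s, elemOf env t])
  | .comp s t => iffClauses (.pair a (.comp s t), env) (leCode, [elemOf env s, elemOf env t])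
  | b => [ [((.pair a b, env), false)] ]

/-- Clauses for the axioms of equality. -/
def eqClauses (x y x' y' : Code) : List Clause :=
  [ [((eqCode, [x, x]), true)],
    [((eqCode, [x, y]), false), ((eqCode, [x, x']), false), ((eqCode, [y, x']), true)],
    [((eqCode, [x, y]), false), ((eqCode, [.rfind' x, .rfind' y]), true)],
    [((eqCode, [x, y]), false), ((eqCode, [x', y']), false),
      ((eqCode, [.pair x x', .pair y y']), true)],
    [((eqCode, [x, y]), false), ((eqCode, [x', y']), false),
      ((eqCode, [.comp x x', .comp y y']), true)],
    [((eqCode, [x, y]), false), ((eqCode, [x', y']), false), ((leCode, [x, x']), false),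
      ((leCode, [y, y']), true)] ]

/-- All the logical clauses with given parameters. -/
def logicalClauses (a b : Code) (env : List Code) (x y z w : Code) : List Clause :=
  impClauses a b env ++ allClauses a env x ++ atomClauses a env b ++ eqClauses x y z w

/-- The valuation `v` satisfies all the logical clauses. -/
structure IsLogical (v : Instance → Prop) : Prop where
  imp (a b : Code) (env : List Code) : v (.prec a b, env) ↔ (v (a, env) → v (b, env))
  all (a : Code) (env : List Code) (x : Code) : v (.rfind' a, env) → v (a, env ++ [x])
  all_of (a : Code) (env : List Code) : v (a, env ++ [witness a env]) → v (.rfind' a, env)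
  atom (a b : Code) (env : List Code) : ∀ C ∈ atomClauses a env b, Sat v C
  refl (x : Code) : v (eqCode, [x, x])
  euclid (x y z : Code) : v (eqCode, [x, y]) → v (eqCode, [x, z]) → v (eqCode, [y, z])
  succ (x y : Code) : v (eqCode, [x, y]) → v (eqCode, [.rfind' x, .rfind' y])
  add (x y x' y' : Code) : v (eqCode, [x, y]) → v (eqCode, [x', y']) →
    v (eqCode, [.pair x x', .pair y y'])
  mul (x y x' y' : Code) : v (eqCode, [x, y]) → v (eqCode, [x', y']) →
    v (eqCode, [.comp x x', .comp y y'])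
  le (x y x' y' : Code) : v (eqCode, [x, y]) → v (eqCode, [x', y']) →
    v (leCode, [x, x']) → v (leCode, [y, y'])

theorem sat_nil (v : Instance → Prop) : Sat v [] ↔ False := by simp [Sat]

theorem sat_cons_true {v : Instance → Prop} {i : Instance} {C : Clause} :
    Sat v ((i, true) :: C) ↔ v i ∨ Sat v C := by
  simp only [Sat, List.exists_mem_cons_iff, iff_true]

theorem sat_cons_false {v : Instance → Prop} {i : Instance} {C : Clause} :
    Sat v ((i, false) :: C) ↔ ¬v i ∨ Sat v C := by
  simp only [Sat, List.exists_mem_cons_iff, Bool.false_eq_true, iff_false]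

theorem forall_mem_iffClauses {v : Instance → Prop} {i j : Instance} :
    (∀ C ∈ iffClauses i j, Sat v C) ↔ (v i ↔ v j) := by
  simp only [iffClauses, sat_nil, sat_cons_true, sat_cons_false, List.forall_mem_cons,
    List.not_mem_nil, IsEmpty.forall_iff, implies_true]
  tauto

theorem forall_mem_logicalClauses {v : Instance → Prop} :
    (∀ a b env x y x' y', ∀ C ∈ logicalClauses a b env x y x' y', Sat v C) ↔ IsLogical v := by
  simp only [logicalClauses, List.forall_mem_append, impClauses, allClauses, eqClauses, sat_nil,
    sat_cons_true, sat_cons_false, List.forall_mem_cons, List.not_mem_nil, or_false,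
    IsEmpty.forall_iff, implies_true, and_true]
  constructor
  · intro H
    have H₁ a b env := (H a b env a a a a).1.1.1
    have H₂ a env x := (H a a env x a a a).1.1.2
    have H₃ x y x' y' := (H x x [] x y x' y').2
    refine ⟨fun a b env => ?_, fun a env x => ?_, fun a env => ?_,
      fun a b env => (H a b env a a a a).1.2, fun x => (H₃ x x x x).1, fun x y z => ?_,
      fun x y => ?_, fun x y x' y' => ?_, fun x y x' y' => ?_, fun x y x' y' => ?_⟩
    · have := H₁ a b env
      tauto
    · have := (H₂ a env x).1
      tauto
    · have := (H₂ a env a).2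
      tauto
    · have := (H₃ x y z z).2.1
      tauto
    · have := (H₃ x y x x).2.2.1
      tauto
    · have := (H₃ x y x' y').2.2.2.1
      tauto
    · have := (H₃ x y x' y').2.2.2.2.1
      tauto
    · have := (H₃ x y x' y').2.2.2.2.2
      tauto
  · intro hv a b env x y x' y'
    refine ⟨⟨⟨?_, ?_, ?_⟩, hv.atom a b env⟩, hv.refl x, ?_, ?_, ?_, ?_, ?_⟩
    · have := hv.imp a b env
      tauto
    · have := hv.all a env x
      tauto
    · have := hv.all_of a env
      tauto
    · have := hv.euclid x y x'
      tauto
    · have := hv.succ x y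
      tauto
    · have := hv.add x y x' y'
      tauto
    · have := hv.mul x y x' y'
      tauto
    · have := hv.le x y x' y'
      tauto

/-! ### The valuation given by a model -/

section Soundness

variable (M : Type) [LA.Structure M] [Nonempty M]

/-- The interpretation of trees as elements of `M`, together with the interpretation of trees
as lists of elements of `M`. -/
noncomputable def interp : Code → M × List M
  | .rfind' t => (succM (interp t).1, [])
  | .pair s t => (addM (interp s).1 (interp t).1, (interp s).1 :: (interp t).2)
  | .comp s t => (mulM (interp s).1 (interp t).1, [])
  | .prec a b => (Classical.epsilon fun x => ¬ Holds a ((interp b).2 ++ [x]), [])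
  | _ => (zeroM M, [])

theorem isInterp_interp : IsInterp fun c => (interp M c).1 :=
  ⟨rfl, fun _ => rfl, fun _ _ => rfl, fun _ _ => rfl⟩

theorem interp_listCode (env : List Code) :
    (interp M (listCode env)).2 = env.map fun c => (interp M c).1 := by
  induction env with
  | nil => rfl
  | cons x env ih => exact congrArg _ ih

theorem isLogical_holds :
    IsLogical fun i => Holds i.1 (i.2.map fun c => (interp M c).1) := by
  have hh := isInterp_interp M
  refine ⟨fun a b env => holds_imp _ _ _, fun a env x H => ?_, fun a env H => ?_,
    fun a b env => ?_, fun x => ?_, fun x y z => ?_, fun x y => ?_, fun x y x' y' => ?_,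
    fun x y x' y' => ?_, fun x y x' y' => ?_⟩
  · simpa using (holds_all _ _).1 H _
  · refine (holds_all _ _).2 ?_
    by_contra! hne
    refine Classical.epsilon_spec hne ?_
    simpa [witness, interp, interp_listCode] using H
  · cases b with
    | pair s t =>
      rw [atomClauses, forall_mem_iffClauses, hh.holds_eq]
      exact (hh.holds_eqCode _ _).symm
    | comp s t =>
      rw [atomClauses, forall_mem_iffClauses, hh.holds_le]
      exact (hh.holds_leCode _ _).symm
    | _ =>
      simp only [atomClauses, List.forall_mem_singleton, sat_nil, sat_cons_false, or_false]
      exact id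
  all_goals simp only [List.map_cons, List.map_nil, hh.holds_eqCode, hh.holds_leCode]
  · exact fun h₁ h₂ => h₁.symm.trans h₂
  · exact fun h => by simp only [hh.succ, h]
  · exact fun h₁ h₂ => by simp only [hh.add, h₁, h₂]
  · exact fun h₁ h₂ => by simp only [hh.mul, h₁, h₂]
  · exact fun h₁ h₂ h => by simpa only [h₁, h₂] using h

end Soundness

/-! ### The model given by a valuation -/

namespace IsLogical

variable {v : Instance → Prop} (hv : IsLogical v)

/-- Trees are identified when the valuation makes them equal. -/
def setoid : Setoid Code where
  r x y := v (eqCode, [x, y])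
  iseqv := ⟨hv.refl, fun {x y} h => hv.euclid x y x h (hv.refl x),
    fun {x y z} h₁ h₂ => hv.euclid y x z (hv.euclid x y x h₁ (hv.refl x)) h₂⟩

/-- The model of trees. -/
abbrev Model : Type := Quotient hv.setoid

instance : Nonempty hv.Model := ⟨Quotient.mk hv.setoid .zero⟩

instance : LA.Structure hv.Model where
  funMap {_} f := match f with
    | ArithFunc.zero => fun _ => Quotient.mk hv.setoid .zero
    | ArithFunc.succ => fun w => Quotient.map Code.rfind' (fun x y h => hv.succ x y h) (w 0)
    | ArithFunc.add => fun w => Quotient.map₂ Code.pair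
        (fun x y h x' y' h' => hv.add x y x' y' h h') (w 0) (w 1)
    | ArithFunc.mul => fun w => Quotient.map₂ Code.comp
        (fun x y h x' y' h' => hv.mul x y x' y' h h') (w 0) (w 1)
  RelMap {_} r := match r with
    | ArithRel.le => fun w => Quotient.lift₂ (fun x y => v (leCode, [x, y]))
        (fun x x' y y' h h' => propext ⟨hv.le x y x' y' h h', hv.le y x y' x'
          (hv.setoid.symm h) (hv.setoid.symm h')⟩) (w 0) (w 1)

theorem isInterp_mk : IsInterp (Quotient.mk hv.setoid) :=
  ⟨rfl, fun _ => rfl, fun _ _ => rfl, fun _ _ => rfl⟩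

theorem iff_holds {c : Code} {env : List Code} (h : codeCtx c = env.length + 1) :
    v (c, env) ↔ Holds c (env.map (Quotient.mk hv.setoid)) := by
  have hh := hv.isInterp_mk
  induction c generalizing env with
  | zero | succ | left | right | comp => simp [codeCtx] at h
  | pair a b =>
    have H := hv.atom a b env
    cases b with
    | pair s t =>
      rw [atomClauses, forall_mem_iffClauses] at H
      rw [H, hh.holds_eq, Quotient.eq]
      rfl
    | comp s t =>
      rw [atomClauses, forall_mem_iffClauses] at H
      rw [H, hh.holds_le]
      rfl
    | _ =>
      simp only [atomClauses, List.forall_mem_singleton, sat_nil, sat_cons_false, or_false] at H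
      exact iff_of_false H id
  | prec a b iha ihb =>
    rw [codeCtx] at h
    split_ifs at h with hab
    rw [hv.imp, holds_imp]
    exact imp_congr (iha h) (ihb (hab ▸ h))
  | rfind' a iha =>
    have h (x : Code) : codeCtx a = (env ++ [x]).length + 1 := by
      rw [codeCtx] at h
      simp
      omega
    rw [holds_all]
    constructor
    · intro H x
      obtain ⟨x, rfl⟩ := Quotient.exists_rep x
      have := (iha (h x)).1 (hv.all a env x H)
      simpa using this
    · intro H
      refine hv.all_of a env ((iha (h _)).2 ?_)
      simpa using H (Quotient.mk hv.setoid (witness a env))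

end IsLogical

/-! ### The clauses are primitive recursive -/

section Primrec

open Primrec Nat.Partrec.Code

variable {α : Type} [Primcodable α]

theorem primrec_list_one {β : Type} [Primcodable β] {f : α → β} (hf : Primrec f) :
    Primrec fun p => [f p] :=
  list_cons.comp hf (.const [])

theorem primrec_list_two {β : Type} [Primcodable β] {f g : α → β} (hf : Primrec f)
    (hg : Primrec g) : Primrec fun p => [f p, g p] :=
  list_cons.comp hf (primrec_list_one hg)

theorem primrec_list_three {β : Type} [Primcodable β] {f g h : α → β} (hf : Primrec f)
    (hg : Primrec g) (hh : Primrec h) : Primrec fun p => [f p, g p, h p] :=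
  list_cons.comp hf (primrec_list_two hg hh)

theorem primrec_literal {c : α → Code} {env : α → List Code} (hc : Primrec c)
    (henv : Primrec env) (b : Bool) : Primrec fun p => (((c p, env p), b) : Instance × Bool) :=
  (hc.pair henv).pair (.const b)

theorem primrec_elemOf : Primrec₂ elemOf := by
  have h := primrec_recOn (α := List Code × Code) (σ := Code) (c := Prod.snd) snd
    (z := fun _ => .zero) (.const _) (s := fun _ => .zero) (.const _)
    (l := fun _ => .zero) (.const _) (r := fun _ => .zero) (.const _)
    (pr := fun _ _ _ x y => .pair x y)
    (primrec₂_pair.comp (fst.comp (snd.comp (snd.comp snd))) (snd.comp (snd.comp (snd.comp snd))))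
    (co := fun _ _ _ x y => .comp x y)
    (primrec₂_comp.comp (fst.comp (snd.comp (snd.comp snd))) (snd.comp (snd.comp (snd.comp snd))))
    (pc := fun p a _ _ _ => p.1.getD (Encodable.encode a) .zero)
    ((list_getD _).comp (fst.comp fst) (Primrec.encode.comp (fst.comp snd)))
    (rf := fun _ _ x => .rfind' x) (primrec_rfind'.comp (snd.comp snd))
  refine Primrec.of_eq h fun p => ?_
  obtain ⟨env, c⟩ := p
  change _ = elemOf env c
  induction c with
  | prec | zero | succ | left | right => rfl
  | _ => simp_all [elemOf]

theorem primrec_listCode : Primrec listCode :=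
  list_foldr (f := id) (g := fun _ => Code.zero) (h := fun _ p => Code.pair p.1 p.2) .id (.const _)
    (primrec₂_pair.comp (fst.comp snd) (snd.comp snd))

theorem primrec_witness : Primrec₂ witness :=
  primrec₂_prec.comp fst (primrec_listCode.comp snd)

theorem primrec_numCode : Primrec numCode :=
  nat_rec₁ _ (primrec_rfind'.comp snd)

theorem primrec_iffClauses {i j : α → Instance} (hi : Primrec i) (hj : Primrec j) :
    Primrec fun p => iffClauses (i p) (j p) :=
  primrec_list_two (primrec_list_two (hi.pair (.const _)) (hj.pair (.const _)))
    (primrec_list_two (hi.pair (.const _)) (hj.pair (.const _)))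

section

variable {a b : α → Code} {env : α → List Code} {x y x' y' : α → Code}

theorem primrec_impClauses (ha : Primrec a) (hb : Primrec b) (henv : Primrec env) :
    Primrec fun p => impClauses (a p) (b p) (env p) := by
  have hab := primrec₂_prec.comp ha hb
  exact primrec_list_three
    (primrec_list_three (primrec_literal hab henv _) (primrec_literal ha henv _)
      (primrec_literal hb henv _))
    (primrec_list_two (primrec_literal hab henv _) (primrec_literal ha henv _))
    (primrec_list_two (primrec_literal hab henv _) (primrec_literal hb henv _))

theorem primrec_allClauses (ha : Primrec a) (henv : Primrec env) (hx : Primrec x) :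
    Primrec fun p => allClauses (a p) (env p) (x p) := by
  have hall := primrec_rfind'.comp ha
  exact primrec_list_two
    (primrec_list_two (primrec_literal hall henv _)
      (primrec_literal ha (list_append.comp henv (primrec_list_one hx)) _))
    (primrec_list_two (primrec_literal hall henv _)
      (primrec_literal ha (list_append.comp henv
        (primrec_list_one (primrec_witness.comp ha henv))) _))

theorem primrec_atomClauses (ha : Primrec a) (hb : Primrec b) (henv : Primrec env) :
    Primrec fun p => atomClauses (a p) (env p) (b p) := by
  have hf (c : Code) :
      Primrec fun p => [ [(((Code.pair (a p) c, env p), false) : Instance × Bool)] ] :=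
    primrec_list_one (primrec_list_one
      (primrec_literal (primrec₂_pair.comp ha (.const c)) henv _))
  have haf : Primrec fun p : α × Code × Code × List Clause × List Clause => a p.1 := ha.comp fst
  have hef : Primrec fun p : α × Code × Code × List Clause × List Clause => env p.1 :=
    henv.comp fst
  have hs : Primrec fun p : α × Code × Code × List Clause × List Clause => p.2.1 :=
    fst.comp snd
  have ht : Primrec fun p : α × Code × Code × List Clause × List Clause => p.2.2.1 :=
    fst.comp (snd.comp snd)
  have hl := primrec_list_two (primrec_elemOf.comp hef hs) (primrec_elemOf.comp hef ht)
  have h := primrec_recOn (α := α) (σ := List Clause) hb (hf .zero) (hf .succ) (hf .left)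
    (hf .right)
    (pr := fun p s t _ _ => atomClauses (a p) (env p) (.pair s t))
    (primrec_iffClauses ((primrec₂_pair.comp haf (primrec₂_pair.comp hs ht)).pair hef)
      ((Primrec.const _).pair hl))
    (co := fun p s t _ _ => atomClauses (a p) (env p) (.comp s t))
    (primrec_iffClauses ((primrec₂_pair.comp haf (primrec₂_comp.comp hs ht)).pair hef)
      ((Primrec.const _).pair hl))
    (pc := fun p s t _ _ => atomClauses (a p) (env p) (.prec s t))
    (primrec_list_one (primrec_list_one
      (primrec_literal (primrec₂_pair.comp haf (primrec₂_prec.comp hs ht)) hef _)))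
    (rf := fun p s _ => atomClauses (a p) (env p) (.rfind' s))
    (primrec_list_one (primrec_list_one (primrec_literal (primrec₂_pair.comp (ha.comp fst)
      (primrec_rfind'.comp (fst.comp snd))) (henv.comp fst) _)))
  refine Primrec.of_eq h fun p => ?_
  cases b p <;> rfl

theorem primrec_eqClauses (hx : Primrec x) (hy : Primrec y) (hx' : Primrec x')
    (hy' : Primrec y') : Primrec fun p => eqClauses (x p) (y p) (x' p) (y' p) := by
  have hl {c : Code} {s t : α → Code} (hs : Primrec s) (ht : Primrec t) (d : Bool) :
      Primrec fun p => (((c, [s p, t p]), d) : Instance × Bool) :=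
    primrec_literal (.const c) (primrec_list_two hs ht) d
  exact list_cons.comp (primrec_list_one (hl hx hx _))
    (list_cons.comp (primrec_list_three (hl hx hy _) (hl hx hx' _) (hl hy hx' _))
    (list_cons.comp (primrec_list_two (hl hx hy _)
      (hl (primrec_rfind'.comp hx) (primrec_rfind'.comp hy) _))
    (primrec_list_three
      (primrec_list_three (hl hx hy _) (hl hx' hy' _)
        (hl (primrec₂_pair.comp hx hx') (primrec₂_pair.comp hy hy') _))
      (primrec_list_three (hl hx hy _) (hl hx' hy' _)
        (hl (primrec₂_comp.comp hx hx') (primrec₂_comp.comp hy hy') _))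
      (list_cons.comp (hl hx hy _)
        (primrec_list_three (hl hx' hy' _) (hl hx hx' _) (hl hy hy' _))))))

end

/-- The parameters of the logical clauses. -/
abbrev Params : Type := Code × Code × List Code × Code × Code × Code × Code

/-- The logical clauses with given parameters. -/
def Params.clauses : Params → List Clause :=
  fun (a, b, env, x, y, x', y') => logicalClauses a b env x y x' y'

theorem primrec_clauses : Primrec Params.clauses := by
  have h₁ : Primrec fun p : Params => p.2.2 := snd.comp snd
  have h₂ : Primrec fun p : Params => p.2.2.2.2 := snd.comp (snd.comp h₁)
  exact list_append.comp (list_append.comp (list_append.comp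
    (primrec_impClauses fst (fst.comp snd) (fst.comp h₁))
    (primrec_allClauses fst (fst.comp h₁) (fst.comp (snd.comp h₁))))
    (primrec_atomClauses fst (fst.comp snd) (fst.comp h₁)))
    (primrec_eqClauses (fst.comp (snd.comp h₁)) (fst.comp h₂) (fst.comp (snd.comp h₂))
      (snd.comp (snd.comp h₂)))

end Primrec

/-! ### Refutability of sets of clauses -/

section Refutable

/-- Every partial valuation, given by the binary digits of a number, violates some clause. -/
def Refutable (K : Clause → Prop) : Prop :=
  ∃ m, ∀ s < 2 ^ m, ∃ C, K C ∧
    ∀ l ∈ C, Encodable.encode l.1 < m ∧ s.testBit (Encodable.encode l.1) ≠ l.2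

theorem not_refutable_iff {K : Clause → Prop} :
    ¬ Refutable K ↔ ∃ v, ∀ C, K C → Sat v C := by
  classical
  constructor
  · intro h
    simp only [Refutable] at h
    push Not at h
    choose s _ hs using h
    refine ⟨fun i => ∀ᶠ m in (Filter.hyperfilter ℕ : Filter ℕ),
      (s m).testBit (Encodable.encode i) = true, fun C hC => ?_⟩
    have hex : ∀ᶠ m in (Filter.hyperfilter ℕ : Filter ℕ),
        ∃ l ∈ C, (s m).testBit (Encodable.encode l.1) = l.2 := by
      have hlarge : ∀ᶠ m in (Filter.hyperfilter ℕ : Filter ℕ),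
          ∀ l ∈ C.toFinset, Encodable.encode l.1 < m := by
        refine (Filter.eventually_all_finset _).2 fun l _ => ?_
        exact Filter.Eventually.filter_mono Nat.hyperfilter_le_atTop
          (Filter.eventually_gt_atTop _)
      filter_upwards [hlarge] with m hm
      obtain ⟨l, hl, hl'⟩ := hs m C hC
      exact ⟨l, hl, hl' (hm l (List.mem_toFinset.2 hl))⟩
    by_contra hsat
    have hno : ∀ᶠ m in (Filter.hyperfilter ℕ : Filter ℕ),
        ∀ l ∈ C.toFinset, (s m).testBit (Encodable.encode l.1) ≠ l.2 := by
      refine (Filter.eventually_all_finset _).2 fun l hl => ?_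
      refine Ultrafilter.eventually_not.2 fun hl' => hsat ⟨l, List.mem_toFinset.1 hl, ?_⟩
      rcases hb : l.2 with _ | _ <;> rw [hb] at hl'
      · refine iff_of_false (fun ht => ?_) Bool.false_ne_true
        obtain ⟨m, h₁, h₂⟩ := (hl'.and ht).exists
        rw [h₁] at h₂
        cases h₂
      · exact iff_of_true hl' rfl
    obtain ⟨m, ⟨l, hl, h₁⟩, h₂⟩ := (hex.and hno).exists
    exact h₂ l (List.mem_toFinset.2 hl) h₁
  · rintro ⟨v, hv⟩ ⟨m, hm⟩
    obtain ⟨C, hC, h⟩ := hm (Nat.ofBits fun i : Fin m =>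
      decide (∃ j : Instance, Encodable.encode j = i ∧ v j)) (Nat.ofBits_lt_two_pow _)
    obtain ⟨l, hl, hv⟩ := hv C hC
    obtain ⟨h₁, h₂⟩ := h l hl
    refine h₂ ?_
    rw [Nat.testBit_ofBits_lt _ _ h₁, Bool.eq_iff_iff, decide_eq_true_iff, ← hv]
    constructor
    · rintro ⟨j, hj, hvj⟩
      rwa [← Encodable.encode_injective hj]
    · exact fun h => ⟨_, rfl, h⟩

open Primrec

theorem primrec_two_pow : Primrec fun m : ℕ => 2 ^ m := by
  refine (nat_rec₁ (f := fun _ x => 2 * x) 1 (nat_double.comp snd)).of_eq fun m => ?_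
  induction m with
  | zero => rfl
  | succ m ih => rw [pow_succ, ← ih, mul_comm]

theorem primrec_testBit : Primrec₂ Nat.testBit := by
  have h : PrimrecRel fun s i : ℕ => s / 2 ^ i % 2 = 1 :=
    Primrec.eq.comp (nat_mod.comp (nat_div.comp fst (primrec_two_pow.comp snd)) (.const 2))
      (.const 1)
  exact Primrec.of_eq h.decide fun p => Nat.testBit_eq_decide_div_mod_eq.symm

theorem SigmaPred.refutable {α : Type} [Primcodable α] {n : ℕ} {K : α → Clause → Prop}
    (hK : SigmaPred (n + 1) fun p : α × Clause => K p.1 p.2) :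
    SigmaPred (n + 1) fun a => Refutable (K a) := by
  have hl : PrimrecRel fun (l : Instance × Bool) (p : ℕ × ℕ) =>
      Encodable.encode l.1 < p.1 ∧ p.2.testBit (Encodable.encode l.1) ≠ l.2 := by
    have he : Primrec fun q : (Instance × Bool) × ℕ × ℕ => Encodable.encode q.1.1 :=
      Primrec.encode.comp (fst.comp fst)
    exact PrimrecPred.and (nat_lt.comp he (fst.comp snd))
      (Primrec.eq.comp (primrec_testBit.comp (snd.comp snd) he) (snd.comp fst)).not
  have hC : SigmaPred (n + 1) fun p : ((α × ℕ) × ℕ) × Clause => K p.1.1.1 p.2 ∧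
      ∀ l ∈ p.2, Encodable.encode l.1 < p.1.1.2 ∧ p.1.2.testBit (Encodable.encode l.1) ≠ l.2 :=
    (hK.comp ((fst.comp (fst.comp fst)).pair snd)).and
      (.of_primrecPred (hl.forall_mem_list.comp snd
        ((snd.comp (fst.comp fst)).pair (snd.comp fst))))
  exact (hC.exists_of_inhabited.forall_lt (primrec_two_pow.comp snd)).exists_nat

end Refutable

/-! ### Provability of instances -/

section Provability

/-- Clauses describing the Henkin models of `T` in which the formula represented by the number `e`
is true (if `b = true`) or false (if `b = false`) of the numeral of `e`. -/
def IsClause (T : LA.Theory) (b : Bool) (e : ℕ) (C : Clause) : Prop :=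
  (∃ p : Params, C ∈ p.clauses) ∨
    (∃ c, (codeCtx c = 1 ∧ C = [((c, []), true)]) ∧
      Encodable.encode (formulaTokens c) ∈ axiomCodes T) ∨
    C = [((Denumerable.ofNat Code e, [numCode e]), b)]

theorem forall_isClause_iff {T : LA.Theory} {b : Bool} {c : Code} {v : Instance → Prop} :
    (∀ C, IsClause T b (Encodable.encode c) C → Sat v C) ↔ IsLogical v ∧
      (∀ d, codeCtx d = 1 → formulaOf 0 d ∈ T → v (d, [])) ∧
      (v (c, [numCode (Encodable.encode c)]) ↔ b = true) := by
  have hsat (i : Instance) (d : Bool) : Sat v [(i, d)] ↔ (v i ↔ d = true) := by simp [Sat]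
  rw [← forall_mem_logicalClauses]
  constructor
  · refine fun h => ⟨fun a b env x y x' y' C hC => h C (.inl ⟨(a, b, env, x, y, x', y'), hC⟩),
      fun d hd hT => ?_, ?_⟩
    · have := (hsat _ _).1 (h _ (.inr (.inl ⟨d, ⟨hd, rfl⟩, (mem_axiomCodes_iff hd).2 hT⟩)))
      exact this.2 rfl
    · have := (hsat _ _).1 (h _ (.inr (.inr rfl)))
      rwa [Denumerable.ofNat_encode] at this
  · rintro ⟨h₁, h₂, h₃⟩ C (⟨⟨a, b, env, x, y, x', y'⟩, hC⟩ | ⟨d, ⟨hd, rfl⟩, hT⟩ | rfl)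
    · exact h₁ a b env x y x' y' C hC
    · exact (hsat _ _).2 (iff_of_true (h₂ d hd ((mem_axiomCodes_iff hd).1 hT)) rfl)
    · rw [hsat, Denumerable.ofNat_encode]
      exact h₃

theorem holds_nil {M : Type} [LA.Structure M] {c : Code} :
    Holds c ([] : List M) ↔ M ⊨ (formulaOf 0 c : LA.Sentence) := by
  rw [Holds, Sentence.Realize, Formula.Realize]
  exact iff_of_eq (congrArg₂ _ (Subsingleton.elim _ _) (funext fun i => i.elim0))

theorem holds_singleton {M : Type} [LA.Structure M] {c : Code} {m : ℕ} :
    Holds c [natM M m] ↔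
      (formulaOf 1 c).Realize (Empty.elim : Empty → M) fun i => natM M (![m] i) :=
  iff_of_eq (congrArg _ (funext fun i => by
    obtain rfl : i = (0 : Fin 1) := Subsingleton.elim (α := Fin 1) i 0
    rfl))

theorem not_refutable_isClause_iff {T : LA.Theory} {b : Bool} {c : Code} (hc : codeCtx c = 2) :
    ¬ Refutable (IsClause T b (Encodable.encode c)) ↔
      ∃ (M : Type) (_ : LA.Structure M) (_ : Nonempty M), M ⊨ T ∧
        ((formulaOf 1 c).Realize (Empty.elim : Empty → M)
          (fun i => natM M (![Encodable.encode c] i)) ↔ b = true) := by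
  simp only [not_refutable_iff, forall_isClause_iff]
  constructor
  · rintro ⟨v, hv, hT, hb⟩
    refine ⟨hv.Model, inferInstance, inferInstance, ⟨fun {φ} hφ => ?_⟩, ?_⟩
    · obtain ⟨d, hd, rfl⟩ := exists_formulaOf φ
      exact holds_nil.1 ((hv.iff_holds hd).1 (hT d hd hφ))
    · rw [← holds_singleton, ← hb, hv.iff_holds hc, ← hv.isInterp_mk.numCode]
      rfl
  · rintro ⟨M, _, _, hT, hb⟩
    refine ⟨_, isLogical_holds M, fun d _ hd => ?_, ?_⟩
    · exact holds_nil.2 (hT.realize_of_mem _ hd)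
    · rw [← hb, ← holds_singleton, ← (isInterp_interp M).numCode]
      rfl

theorem refutable_false_iff {T : LA.Theory} {c : Code} (hc : codeCtx c = 2) :
    Refutable (IsClause T false (Encodable.encode c)) ↔
      ProvesAt T (formulaOf 1 c) ![Encodable.encode c] := by
  rw [← not_iff_not, not_refutable_isClause_iff hc, ProvesAt]
  simp only [Bool.false_eq_true, iff_false]
  push Not
  simp only [exists_prop]

theorem refutable_true_iff {T : LA.Theory} {c : Code} (hc : codeCtx c = 2) :
    Refutable (IsClause T true (Encodable.encode c)) ↔
      ProvesAt T (∼(formulaOf 1 c)) ![Encodable.encode c] := by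
  rw [← not_iff_not, not_refutable_isClause_iff hc, ProvesAt]
  simp only [iff_true, realize_not]
  push Not
  simp only [exists_prop]

open Primrec

theorem SigmaDefinable.sigmaPred {n : ℕ} {A : Set ℕ} (h : SigmaDefinable n A) :
    SigmaPred n (· ∈ A) := by
  obtain ⟨Ψ, hΨ, hA⟩ := h
  refine (hΨ.sigmaPred (f := fun _ => id) fun _ => .id).of_iff fun m => ((hA m).trans ?_).symm
  refine iff_of_eq (congrArg₂ _ (Subsingleton.elim _ _) (funext fun i => ?_))
  obtain rfl := Subsingleton.elim i 0
  rfl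

theorem sigmaPred_refutable {T : LA.Theory} {n : ℕ} (hT : SigmaDefinable (n + 1) (axiomCodes T))
    (b : Bool) : SigmaPred (n + 1) fun e => Refutable (IsClause T b e) := by
  refine SigmaPred.refutable (.or ?_ (.or ?_ ?_))
  · have h : PrimrecPred fun q : (ℕ × Clause) × Params => q.1.2 ∈ q.2.clauses :=
      ((Primrec.eq (α := Clause)).exists_mem_list.comp (primrec_clauses.comp snd)
        (snd.comp fst)).of_eq fun q => by simp
    exact (SigmaPred.of_primrecPred h).exists_of_inhabited
  · have h : PrimrecPred fun q : (ℕ × Clause) × Code =>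
        codeCtx q.2 = 1 ∧ q.1.2 = [((q.2, []), true)] :=
      PrimrecPred.and (Primrec.eq.comp (primrec_codeCtx.comp snd) (.const 1))
        (Primrec.eq.comp (snd.comp fst)
          (primrec_list_one (primrec_literal snd (.const []) true)))
    exact (SigmaPred.and (.of_primrecPred h) (hT.sigmaPred.comp
      (Primrec.encode.comp (primrec_formulaTokens.comp snd)))).exists_of_inhabited
  · exact .of_primrecPred (Primrec.eq.comp snd (primrec_list_one (primrec_literal
      ((Primrec.ofNat Code).comp fst) (primrec_list_one (primrec_numCode.comp fst)) b)))

end Provability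

end Codes

/-! ### Rosser's formula -/

/-- The formula stating that each `y` satisfying `∼σ(x, y)` has some `z ≤ y` satisfying
`π(x, z)`. -/
def rosser (σ π : LA.BoundedFormula Empty 2) : LA.BoundedFormula Empty 1 :=
  (σ ⊔ (leF (&(Fin.last 2)) (liftT (&1)) ⊓ inst ![&0, &2] π).ex).all

theorem realize_rosser {σ π : LA.BoundedFormula Empty 2} {M : Type} [LA.Structure M]
    (xs : Fin 1 → M) :
    (rosser σ π).Realize (Empty.elim : Empty → M) xs ↔
      ∀ y, σ.Realize (Empty.elim : Empty → M) (Fin.snoc xs y) ∨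
        ∃ z, leM z y ∧ π.Realize (Empty.elim : Empty → M) (Fin.snoc xs z) := by
  simp only [rosser, realize_all, realize_sup, realize_ex, realize_inf, realize_leF,
    realize_liftT, realize_inst]
  refine forall_congr' fun y => or_congr Iff.rfl (exists_congr fun z => and_congr Iff.rfl ?_)
  refine iff_of_eq (congrArg _ (funext fun i => ?_))
  fin_cases i <;> rfl

section Rosser

variable {T : LA.Theory} {n : ℕ}

theorem provesAt_not_rosser (hQ : ExtendsQ T) (hcon : NCon n T)
    (hdec : ∀ γ : LA.Sentence, IsPi (n + 1) γ → Proves T γ ∨ Proves T (∼γ))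
    {σ₁ π₁ σ₂ π₂ : LA.BoundedFormula Empty 2} (h₁ : DualPair n σ₁ π₁) (h₂ : DualPair n σ₂ π₂)
    {xs : Fin 1 → ℕ} (hx₁ : π₁.ex.Realize (Empty.elim : Empty → ℕ) xs)
    (hx₂ : ¬ π₂.ex.Realize (Empty.elim : Empty → ℕ) xs) :
    ProvesAt T (∼(rosser σ₁ π₂)) xs := by
  intro M _ _ hM
  rw [realize_not, realize_rosser]
  obtain ⟨y, hy⟩ := realize_ex.1 hx₁
  intro H
  have hy' := (h₁.provesAt hQ hcon hdec le_rfl _).2 hy M hM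
  rw [← natM_comp_snoc, h₁.realize_iff_not] at hy'
  obtain ⟨z, hz, hz'⟩ := (H (natM M y)).resolve_left hy'
  obtain ⟨i, -, rfl⟩ := (isQModel_of_extendsQ hQ hM).le_natM_iff.1 hz
  have hi : σ₂.Realize (Empty.elim : Empty → ℕ) (Fin.snoc xs i) := by
    by_contra hi
    exact hx₂ (realize_ex.2 ⟨i, (h₂.realize_iff_not _ _).2 hi⟩)
  have hi' := (h₂.provesAt hQ hcon hdec le_rfl _).1 hi M hM
  rw [← natM_comp_snoc] at hi'
  exact (h₂.realize_iff_not _ _).1 hz' hi'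

theorem provesAt_rosser (hQ : ExtendsQ T) (hcon : NCon n T)
    (hdec : ∀ γ : LA.Sentence, IsPi (n + 1) γ → Proves T γ ∨ Proves T (∼γ))
    {σ₁ π₁ σ₂ π₂ : LA.BoundedFormula Empty 2} (h₁ : DualPair n σ₁ π₁) (h₂ : DualPair n σ₂ π₂)
    {xs : Fin 1 → ℕ} (hx₁ : ¬ π₁.ex.Realize (Empty.elim : Empty → ℕ) xs)
    (hx₂ : π₂.ex.Realize (Empty.elim : Empty → ℕ) xs) :
    ProvesAt T (rosser σ₁ π₂) xs := by
  intro M _ _ hM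
  rw [realize_rosser]
  intro y
  obtain ⟨z, hz⟩ := realize_ex.1 hx₂
  rcases (isQModel_of_extendsQ hQ hM).le_or_natM_le y z with ⟨i, -, rfl⟩ | hzy
  · have hi : σ₁.Realize (Empty.elim : Empty → ℕ) (Fin.snoc xs i) := by
      by_contra hi
      exact hx₁ (realize_ex.2 ⟨i, (h₁.realize_iff_not _ _).2 hi⟩)
    have hi' := (h₁.provesAt hQ hcon hdec le_rfl _).1 hi M hM
    rw [← natM_comp_snoc] at hi'
    exact .inl hi'
  · have hzM := (h₂.provesAt hQ hcon hdec le_rfl _).2 hz M hM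
    rw [← natM_comp_snoc] at hzM
    exact .inr ⟨_, hzy, hzM⟩

/-- A form of `φ(e)` in which the numeral is not substituted. -/
def atNumeral (φ : LA.BoundedFormula Empty 1) (e : ℕ) : LA.Sentence :=
  (∼(&0 =' liftT (numSub ![e] 0)) ⊔ φ).all

theorem IsPi.atNumeral {φ : LA.BoundedFormula Empty 1} (h : IsPi (n + 1) φ) (e : ℕ) :
    IsPi (n + 1) (atNumeral φ e) :=
  .all (.sup (.mono (.ofDelta0 (Delta0.equal _ _).not) (Nat.zero_le _)) h)

theorem realize_atNumeral {φ : LA.BoundedFormula Empty 1} {e : ℕ} {M : Type} [LA.Structure M] :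
    BoundedFormula.Realize (atNumeral φ e) (Empty.elim : Empty → M) (fun i => i.elim0) ↔
      φ.Realize (Empty.elim : Empty → M) fun i => natM M (![e] i) := by
  have hsnoc (x : M) : (Fin.snoc (fun i : Fin 0 => i.elim0) x : Fin 1 → M) = fun _ => x := by
    funext i
    obtain rfl : i = 0 := Subsingleton.elim (α := Fin 1) i 0
    rfl
  have hvec : (fun i => natM M (![e] i)) = fun _ => natM M e := by
    funext i
    obtain rfl := Subsingleton.elim i 0
    rfl
  simp only [GRNonRE.atNumeral, realize_all, realize_sup, realize_not, realize_bdEqual,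
    realize_liftT, realize_numSub, hvec]
  simp only [hsnoc]
  constructor
  · exact fun h => (h (natM M e)).resolve_left fun hne => hne rfl
  · rintro h x
    by_cases hx : x = natM M e
    · exact .inr (hx ▸ h)
    · exact .inl hx

theorem proves_atNumeral_iff {φ : LA.BoundedFormula Empty 1} {e : ℕ} :
    Proves T (atNumeral φ e) ↔ ProvesAt T φ ![e] := by
  simp only [proves_iff, ProvesAt, realize_atNumeral]

theorem proves_not_atNumeral_iff {φ : LA.BoundedFormula Empty 1} {e : ℕ} :
    Proves T (∼(atNumeral φ e)) ↔ ProvesAt T (∼φ) ![e] := by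
  simp only [proves_iff, ProvesAt, realize_not, realize_atNumeral]

theorem Consistent.not_provesAt_not (h : Consistent T) {k : ℕ} {φ : LA.BoundedFormula Empty k}
    {xs : Fin k → ℕ} (hφ : ProvesAt T φ xs) : ¬ ProvesAt T (∼φ) xs := fun hφ' =>
  h (proves_iff.2 fun M _ _ hM => (realize_not.1 (hφ' M hM) (hφ M hM)).elim)

end Rosser

/-- **Corollary 2.11** (generalized Gödel–Rosser).  No `(n-1)`-consistent and
`Σₙ`-definable (`n ≥ 1`) extension of `Q` is `Πₙ`-deciding (for `n = 1`,
`0`-consistency is ordinary consistency). -/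
theorem godel_rosser_generalized (n : ℕ) (hn : 1 ≤ n)
    (T : LA.Theory) (hQ : ExtendsQ T) (hcon : NCon (n - 1) T)
    (hdef : SigmaDefinable n (axiomCodes T)) :
    ∃ γ : LA.Sentence, IsPi n γ ∧ ¬ Proves T γ ∧ ¬ Proves T (∼γ) := by
  obtain ⟨n, rfl⟩ := Nat.exists_eq_add_of_le' hn
  rw [Nat.add_sub_cancel] at hcon
  by_contra! hdec'
  have hdec (γ : LA.Sentence) (hγ : IsPi (n + 1) γ) : Proves T γ ∨ Proves T (∼γ) :=
    or_iff_not_imp_left.2 (hdec' γ hγ)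
  have hex (b : Bool) : ∃ σ π : LA.BoundedFormula Empty 2, DualPair n σ π ∧
      ∀ e, π.ex.Realize (Empty.elim : Empty → ℕ) ![e] ↔ Refutable (IsClause T b e) := by
    obtain ⟨σ, π, h, H⟩ := (sigmaPred_refutable hdef b).exists_dualPair
      (g := fun v : Fin 1 → ℕ => v 0) (.proj 0)
    cases h with
    | succ h => exact ⟨_, _, h, fun e => H ![e]⟩
  obtain ⟨σ₁, π₁, h₁, H₁⟩ := hex false
  obtain ⟨σ₂, π₂, h₂, H₂⟩ := hex true
  obtain ⟨c, hc, hρ⟩ := exists_formulaOf (rosser σ₁ π₂)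
  have hA := (H₁ _).trans (refutable_false_iff hc)
  have hB := (H₂ _).trans (refutable_true_iff hc)
  rw [hρ] at hA hB
  have hPi : IsPi (n + 1) (rosser σ₁ π₂) :=
    .all (.sup (.ofSigma h₁.isSigma_isPi.1) (.bdex _ ((h₂.inst _).isSigma_isPi.2.mono n.le_succ)))
  rcases hdec _ (hPi.atNumeral (Encodable.encode c)) with h | h
  · rw [proves_atNumeral_iff] at h
    have h' := hcon.consistent.not_provesAt_not h
    exact h' (provesAt_not_rosser hQ hcon hdec h₁ h₂ (hA.2 h) (mt hB.1 h'))
  · rw [proves_not_atNumeral_iff] at h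
    have h' := mt hcon.consistent.not_provesAt_not (not_not.2 h)
    exact h' (provesAt_rosser hQ hcon hdec h₁ h₂ (mt hA.1 h') (hB.2 h))

end GRNonRE
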